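/- arXiv:2108.13548 — 12 statements merged into one kernel-verified Lean document; each statement's English description precedes it below -/
import Mathlib

section
/- Let A be an abelian group, n ≥ 0, e₁,…,eₙ ∈ A, and let 𝒬_q = {(a,I) : a ∈ A, I ⊆ {1,…,n}, |I| = q}, writing □(a,I) for such a pair. Suppose w assigns to every pair □(a,I) an integer such that for every i ∈ I one has w(□(a,I)) ≥ w(□(a, I∖{i})) and w(□(a,I)) ≥ w(□(a+eᵢ, I∖{i})). Let M be a module over the polynomial ring 𝔽₂[U]. For a function φ : 𝒬_q → M define δ_w φ : 𝒬_{q+1} → M by (δ_w φ)(□(a,I)) = Σ_{i∈I} [ U^{w(□(a,I)) − w(□(a,I∖{i}))} · φ(□(a,I∖{i})) + U^{w(□(a,I)) − w(□(a+eᵢ,I∖{i}))} · φ(□(a+eᵢ,I∖{i})) ]. Then δ_w(δ_w φ) = 0 for every φ : 𝒬_q → M and every q. -/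
open Polynomial

/-- The weighted coboundary map `δ_w` of lattice cohomology.  Cubes `□(a, I)` are modelled as
pairs `(a, I) : A × Finset (Fin n)`, `M` is a module over `𝔽₂[U]`, and for a function
`φ : cubes → M` we set
`(δ_w φ)(□(a,I)) = ∑_{i ∈ I} [U^{w(□(a,I)) − w(□(a,I∖{i}))} · φ(□(a,I∖{i}))
                              + U^{w(□(a,I)) − w(□(a+eᵢ,I∖{i}))} · φ(□(a+eᵢ,I∖{i}))]`. -/
noncomputable def deltaW {A : Type*} [AddCommGroup A] {n : ℕ} (e : Fin n → A)
    (w : A × Finset (Fin n) → ℤ) {M : Type*} [AddCommGroup M]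
    [Module (Polynomial (ZMod 2)) M]
    (φ : A × Finset (Fin n) → M) : A × Finset (Fin n) → M :=
  fun p => ∑ i ∈ p.2,
    ((X : Polynomial (ZMod 2)) ^ (w p - w (p.1, p.2.erase i)).toNat • φ (p.1, p.2.erase i)
      + (X : Polynomial (ZMod 2)) ^ (w p - w (p.1 + e i, p.2.erase i)).toNat •
          φ (p.1 + e i, p.2.erase i))

/-- if `w` is a compatible system of weights (i.e. the weight of a cube dominates
the weights of its faces), then `δ_w ∘ δ_w = 0` on functions from cubes to an `𝔽₂[U]`-module. -/
theorem deltaW_squared_zero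
    {A : Type*} [AddCommGroup A] {n : ℕ} (e : Fin n → A)
    (w : A × Finset (Fin n) → ℤ)
    (hw : ∀ (a : A) (I : Finset (Fin n)) (i : Fin n), i ∈ I →
      w (a, I.erase i) ≤ w (a, I) ∧ w (a + e i, I.erase i) ≤ w (a, I))
    {M : Type*} [AddCommGroup M] [Module (Polynomial (ZMod 2)) M]
    (φ : A × Finset (Fin n) → M) :
    deltaW e w (deltaW e w φ) = 0 := by
  have two : ∀ x : M, x + x = 0 := by
    intro x
    have h : ((1 : Polynomial (ZMod 2)) + 1) = 0 := CharTwo.add_self_eq_zero 1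
    have h2 : ((1 : Polynomial (ZMod 2)) + 1) • x = x + x := by rw [add_smul, one_smul]
    rw [← h2, h, zero_smul]
  funext p
  obtain ⟨a, I⟩ := p
  have comb : ∀ (u v t : ℤ) (x : M), v ≤ u → t ≤ v →
      (X : Polynomial (ZMod 2)) ^ (u - v).toNat • (X : Polynomial (ZMod 2)) ^ (v - t).toNat • x
        = (X : Polynomial (ZMod 2)) ^ (u - t).toNat • x := by
    intro u v t x h1 h2
    rw [smul_smul, ← pow_add]
    congr 2
    omega
  let T : A → Finset (Fin n) → M := fun b J =>
    (X : Polynomial (ZMod 2)) ^ (w (a, I) - w (b, J)).toNat • φ (b, J)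
  let G : Fin n → Fin n → M := fun i j =>
    (T a ((I.erase i).erase j) + T (a + e j) ((I.erase i).erase j))
      + (T (a + e i) ((I.erase i).erase j) + T (a + e i + e j) ((I.erase i).erase j))
  have hG : ∀ i j, G i j = G j i := by
    intro i j
    simp only [G]
    rw [Finset.erase_right_comm, add_right_comm a (e i) (e j)]
    abel
  have key : deltaW e w (deltaW e w φ) (a, I) = ∑ i ∈ I, ∑ j ∈ I.erase i, G i j := by
    simp only [deltaW]
    refine Finset.sum_congr rfl fun i hi => ?_
    rw [Finset.smul_sum, Finset.smul_sum, ← Finset.sum_add_distrib]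
    refine Finset.sum_congr rfl fun j hj => ?_
    have h0 := hw a I i hi
    have h1 := hw a (I.erase i) j hj
    have h2 := hw (a + e i) (I.erase i) j hj
    rw [smul_add, smul_add, comb _ _ _ _ h0.1 h1.1, comb _ _ _ _ h0.1 h1.2,
      comb _ _ _ _ h0.2 h2.1, comb _ _ _ _ h0.2 h2.2]
  rw [key, Finset.sum_sigma', Pi.zero_apply]
  refine Finset.sum_involution (fun x _ => ⟨x.2, x.1⟩) ?_ ?_ ?_ ?_
  · rintro ⟨i, j⟩ _
    change G i j + G j i = 0
    rw [hG j i]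
    exact two _
  · rintro ⟨i, j⟩ hx _ h
    simp only [Finset.mem_sigma, Finset.mem_erase] at hx
    exact hx.2.1 (congrArg Sigma.fst h)
  · rintro ⟨i, j⟩ hx
    simp only [Finset.mem_sigma, Finset.mem_erase] at hx ⊢
    exact ⟨hx.2.2, hx.2.1.symm, hx.1⟩
  · rintro ⟨i, j⟩ _
    rfl
end

section
/- Let B be a symmetric s × s integer matrix and let c₁,…,c_m be a (−2)-chain in B, i.e. distinct indices with B_{cᵢcᵢ} = −2 for all i, B_{cᵢc_{i+1}} = 1 for 1 ≤ i < m, and B_{cᵢc_j} = 0 whenever |i − j| ≥ 2. Suppose k ∈ ℤ^s and there are positions 1 ≤ p < q ≤ m with q ≥ p + 2, a sign ε ∈ {+1, −1}, such that k_{c_p} = 0, k_{c_{p+1}} = 2ε, k_{c_l} = 0 for all p+1 < l < q, and k_{c_q} = −2ε. Then k is equivalent (by a finite sequence of elementary moves for B) to a vector k″ with k″_{c_p} = 2ε, k″_{c_{q−1}} = −2ε, k″_{c_l} = 0 for all p < l < q−1 and for l = q, and k″_{c_l} = k_{c_l} for all chain positions l < p and l > q. -/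
/-- An elementary move for a symmetric integer matrix `B`: replace `k` by `k + 2Beᵢ` for an
index `i` with `kᵢ = −Bᵢᵢ`, or by `k − 2Beᵢ` for an index `i` with `kᵢ = Bᵢᵢ`
(`Beᵢ` is the `i`-th column of `B`). -/
def IsElemMove {s : ℕ} (B : Matrix (Fin s) (Fin s) ℤ) (k k' : Fin s → ℤ) : Prop :=
  ∃ i : Fin s,
    (k i = -B i i ∧ k' = fun v => k v + 2 * B v i) ∨
    (k i = B i i ∧ k' = fun v => k v - 2 * B v i)

/-- Two vectors are equivalent if one is obtained from the other by a finite sequence of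
elementary moves. -/
def MoveEquiv {s : ℕ} (B : Matrix (Fin s) (Fin s) ℤ) : (Fin s → ℤ) → (Fin s → ℤ) → Prop :=
  Relation.ReflTransGen (IsElemMove B)

/-- the `(±2, ∓2)`-slide lemma.  Within a `(−2)`-chain `c₁, …, c_m` of a
symmetric integer matrix `B`, if the chain subvector of `k` has the shape
`(…, 0, ±2, 0, …, 0, ∓2, …)` at positions `p < q` with `q ≥ p + 2` (positions here are
`0`-indexed by `Fin m`), then `k` is equivalent to a vector `k″` whose chain subvector is
`(…, ±2, 0, …, 0, ∓2, 0, …)`, agreeing with that of `k` at chain positions `< p` and `> q`. -/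
theorem slide_lemma {s m : ℕ}
    (B : Matrix (Fin s) (Fin s) ℤ) (hsymm : ∀ a b : Fin s, B a b = B b a)
    (c : Fin m → Fin s) (hinj : Function.Injective c)
    (hdiag : ∀ i : Fin m, B (c i) (c i) = -2)
    (hadj : ∀ i j : Fin m, (i : ℕ) + 1 = (j : ℕ) → B (c i) (c j) = 1)
    (hfar : ∀ i j : Fin m, (i : ℕ) + 2 ≤ (j : ℕ) ∨ (j : ℕ) + 2 ≤ (i : ℕ) →
      B (c i) (c j) = 0)
    (k : Fin s → ℤ) (ε : ℤ) (hε : ε = 1 ∨ ε = -1)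
    (p q : Fin m) (hpq : (p : ℕ) + 2 ≤ (q : ℕ))
    (hkp : k (c p) = 0)
    (hkp1 : ∀ l : Fin m, (l : ℕ) = (p : ℕ) + 1 → k (c l) = 2 * ε)
    (hkmid : ∀ l : Fin m, (p : ℕ) + 1 < (l : ℕ) → (l : ℕ) < (q : ℕ) → k (c l) = 0)
    (hkq : k (c q) = -2 * ε) :
    ∃ k'' : Fin s → ℤ, MoveEquiv B k k'' ∧
      k'' (c p) = 2 * ε ∧
      (∀ l : Fin m, (l : ℕ) + 1 = (q : ℕ) → k'' (c l) = -2 * ε) ∧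
      (∀ l : Fin m, (p : ℕ) < (l : ℕ) → (l : ℕ) + 1 < (q : ℕ) → k'' (c l) = 0) ∧
      k'' (c q) = 0 ∧
      (∀ l : Fin m, (l : ℕ) < (p : ℕ) ∨ (q : ℕ) < (l : ℕ) → k'' (c l) = k (c l)) := by
  have hmove : ∀ (k : Fin s → ℤ) (i : Fin m), k (c i) = 2 * ε →
      IsElemMove B k (fun v => k v + 2 * ε * B v (c i)) := by
    intro k i h
    refine ⟨c i, ?_⟩
    rcases hε with rfl | rfl
    · left
      exact ⟨by rw [h, hdiag]; norm_num, by funext v; ring⟩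
    · right
      exact ⟨by rw [h, hdiag]; norm_num, by funext v; ring⟩
  have hadj' : ∀ i j : Fin m, (j : ℕ) + 1 = (i : ℕ) → B (c i) (c j) = 1 := by
    intro i j h
    rw [hsymm]
    exact hadj j i h
  have hdiag' : ∀ i j : Fin m, (i : ℕ) = (j : ℕ) → B (c i) (c j) = -2 := by
    intro i j h
    rw [Fin.ext h]
    exact hdiag j
  have key : ∀ n : ℕ, (p : ℕ) + 2 + n ≤ (q : ℕ) → ∃ k' : Fin s → ℤ, MoveEquiv B k k' ∧
      k' (c p) = 2 * ε ∧
      (∀ l : Fin m, (p : ℕ) < (l : ℕ) → (l : ℕ) < (p : ℕ) + 1 + n → k' (c l) = 0) ∧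
      (∀ l : Fin m, (l : ℕ) = (p : ℕ) + 1 + n → k' (c l) = -2 * ε) ∧
      (∀ l : Fin m, (l : ℕ) = (p : ℕ) + 2 + n → k' (c l) = k (c l) + 2 * ε) ∧
      (∀ l : Fin m, (l : ℕ) < (p : ℕ) ∨ (p : ℕ) + 2 + n < (l : ℕ) →
        k' (c l) = k (c l)) := by
    intro n
    induction n with
    | zero =>
      intro hn
      have hlt : (p : ℕ) + 1 < m := by have := q.isLt; omega
      refine ⟨_, Relation.ReflTransGen.single
        (hmove k ⟨(p : ℕ) + 1, hlt⟩ (hkp1 _ rfl)), ?_, ?_, ?_, ?_, ?_⟩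
      · rw [hkp, hadj _ _ (by simp)]; ring
      · intro l h1 h2; omega
      · intro l h
        rw [hkp1 l (by omega), hdiag' _ _ (by simp; omega)]; ring
      · intro l h
        rw [hadj' _ _ (by simp; omega)]; ring
      · intro l h
        rw [hfar _ _ (by simp; omega)]; ring
    | succ n ih =>
      intro hn
      obtain ⟨k', he, h1, h2, h3, h4, h5⟩ := ih (by omega)
      have hlt : (p : ℕ) + 2 + n < m := by have := q.isLt; omega
      have hv : k' (c ⟨(p : ℕ) + 2 + n, hlt⟩) = 2 * ε := by
        rw [h4 _ rfl, hkmid _ (by simp; omega) (by simp; omega)]; ring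
      refine ⟨_, Relation.ReflTransGen.tail he (hmove k' _ hv), ?_, ?_, ?_, ?_, ?_⟩
      · rw [h1, hfar _ _ (by simp <;> omega)]; ring
      · intro l ha hb
        rcases Nat.lt_or_ge (l : ℕ) ((p : ℕ) + 1 + n) with hc | hc
        · rw [h2 l ha hc, hfar _ _ (by simp; omega)]; ring
        · rw [h3 l (by omega), hadj _ _ (by simp; omega)]; ring
      · intro l h
        have hl : l = ⟨(p : ℕ) + 2 + n, hlt⟩ := Fin.ext (by simp; omega)
        rw [hl, hv, hdiag]; ring
      · intro l h
        rw [h5 l (by omega), hadj' _ _ (by simp; omega)]; ring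
      · intro l h
        rw [h5 l (by omega), hfar _ _ (by simp; omega)]; ring
  obtain ⟨k', he, h1, h2, h3, h4, h5⟩ := key ((q : ℕ) - (p : ℕ) - 2) (by omega)
  refine ⟨k', he, h1, fun l h => h3 l (by omega), fun l ha hb => h2 l ha (by omega), ?_,
    fun l h => h5 l (by omega)⟩
  rw [h4 q (by omega), hkq]; ring
end

section
/- Let B be a symmetric s × s integer matrix and let c₁,…,c_m be a (−2)-chain in B, i.e. distinct indices with B_{cᵢcᵢ} = −2 for all i, B_{cᵢc_{i+1}} = 1 for 1 ≤ i < m, and B_{cᵢc_j} = 0 whenever |i − j| ≥ 2. Suppose k ∈ ℤ^s satisfies k_{c_{j+1}} = 2 for some 0 ≤ j ≤ m−1 and k_{c_l} = 0 for every other chain position l. Then k is equivalent (by a finite sequence of elementary moves for B) to a vector k″ with k″_{c_{m−j}} = −2 and k″_{c_l} = 0 for every other chain position l. If moreover m ≥ 2 and each interior chain vertex has no other neighbors (i.e. for 1 < i < m, B_{cᵢ,v} = 0 for every v ∉ {c_{i−1}, cᵢ, c_{i+1}}), then k″ can be chosen so that in addition k″_v = k_v + 2·B_{v,c₁} + 2·B_{v,c_m}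 for every index v not among c₁,…,c_m. -/
/-- The indicator function of the block `[q, q+p]` with the hole `q + r`. -/
def chainChi (p q r t : ℕ) : ℤ := if q ≤ t ∧ t ≤ q + p ∧ t ≠ q + r then 1 else 0

/-- The invariant carried along the sequence of moves. -/
def ChainInv {s m : ℕ} (B : Matrix (Fin s) (Fin s) ℤ) (c : Fin m → Fin s) (hm : 0 < m)
    (k : Fin s → ℤ) (H : Prop) (χ : ℕ → ℤ) : Prop :=
  ∃ k' : Fin s → ℤ, MoveEquiv B k k' ∧
    (∀ l : Fin m, k' (c l) = 2 * (χ l - χ (l + 1))) ∧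
    (H → ∀ v : Fin s, (∀ l : Fin m, v ≠ c l) →
      k' v = k v + 2 * B v (c ⟨0, hm⟩) * (1 - χ 0)
        + 2 * B v (c ⟨m - 1, Nat.sub_lt hm Nat.one_pos⟩) * χ m)

theorem ChainInv.step {s m : ℕ}
    (B : Matrix (Fin s) (Fin s) ℤ) (hsymm : ∀ a b : Fin s, B a b = B b a)
    (c : Fin m → Fin s) (hm : 0 < m)
    (hdiag : ∀ i : Fin m, B (c i) (c i) = -2)
    (hadj : ∀ i j : Fin m, (i : ℕ) + 1 = (j : ℕ) → B (c i) (c j) = 1)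
    (hfar : ∀ i j : Fin m, (i : ℕ) + 2 ≤ (j : ℕ) ∨ (j : ℕ) + 2 ≤ (i : ℕ) →
      B (c i) (c j) = 0)
    (k : Fin s → ℤ) (H : Prop)
    (hH : H → 2 ≤ m ∧ ∀ i : Fin m, 0 < (i : ℕ) → (i : ℕ) + 1 < m →
        ∀ v : Fin s, (∀ l : Fin m, v ≠ c l) → B v (c i) = 0)
    (χ χ' : ℕ → ℤ) (l : ℕ) (hl : l < m)
    (h1 : χ l = 1) (h2 : χ (l + 1) = 0) (h1' : χ' l = 0) (h2' : χ' (l + 1) = 1)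
    (ho : ∀ t, t ≠ l → t ≠ l + 1 → χ' t = χ t)
    (h : ChainInv B c hm k H χ) : ChainInv B c hm k H χ' := by
  obtain ⟨k', hk, hc, hoff⟩ := h
  refine ⟨fun v => k' v + 2 * B v (c ⟨l, hl⟩), hk.tail ⟨c ⟨l, hl⟩, Or.inl ⟨?_, rfl⟩⟩, ?_, ?_⟩
  · rw [hc, hdiag]; simp [h1, h2]
  · intro i
    show k' (c i) + 2 * B (c i) (c ⟨l, hl⟩) = _
    rw [hc]
    obtain ⟨i, hi⟩ := i
    show 2 * (χ i - χ (i + 1)) + _ = 2 * (χ' i - χ' (i + 1))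
    by_cases e1 : i = l
    · subst e1
      rw [hdiag, h1, h2, h1', h2']; norm_num
    by_cases e2 : i + 1 = l
    · subst e2
      rw [hadj _ _ rfl, ho i (by omega) (by omega), h1, h1']; ring
    by_cases e3 : l + 1 = i
    · subst e3
      rw [hsymm, hadj _ _ rfl, ho (l + 1 + 1) (by omega) (by omega), h2, h2']; ring
    · rw [hfar _ _ (by simp only; omega), ho i (by omega) (by omega),
        ho (i + 1) (by omega) (by omega)]; ring
  · intro hh v hv
    obtain ⟨hm2, hint⟩ := hH hh
    show k' v + 2 * B v (c ⟨l, hl⟩) = _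
    rw [hoff hh v hv]
    by_cases e1 : l = 0
    · subst e1
      rw [h1, h1', ho m (by omega) (by omega)]; ring
    by_cases e2 : l = m - 1
    · subst e2
      have e : m - 1 + 1 = m := by omega
      rw [e] at h2 h2'
      rw [h2, h2', ho 0 (by omega) (by omega)]; ring
    · rw [hint ⟨l, hl⟩ (by simp only; omega) (by simp only; omega) v hv,
        ho m (by omega) (by omega), ho 0 (by omega) (by omega)]; ring

/-- along a `(−2)`-chain `c₁, …, c_m` of a symmetric integer matrix `B`, a
vector whose chain subvector is `(0, …, 0, 2, 0, …, 0)` (the `2` at the `0`-indexed position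
`jf`) is equivalent to a vector whose chain subvector is `(0, …, 0, −2, 0, …, 0)` with the
`−2` at the mirror position `jf.rev`.  If moreover `m ≥ 2` and the interior chain vertices
have no neighbours outside the chain, then the equivalent vector can be chosen so that, in
addition, every entry off the chain changes exactly by `2·B_{v,c₁} + 2·B_{v,c_m}`. -/
theorem chain_mirror_lemma {s m : ℕ}
    (B : Matrix (Fin s) (Fin s) ℤ) (hsymm : ∀ a b : Fin s, B a b = B b a)
    (c : Fin m → Fin s) (hinj : Function.Injective c)
    (hdiag : ∀ i : Fin m, B (c i) (c i) = -2)
    (hadj : ∀ i j : Fin m, (i : ℕ) + 1 = (j : ℕ) → B (c i) (c j) = 1)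
    (hfar : ∀ i j : Fin m, (i : ℕ) + 2 ≤ (j : ℕ) ∨ (j : ℕ) + 2 ≤ (i : ℕ) →
      B (c i) (c j) = 0)
    (k : Fin s → ℤ) (jf : Fin m)
    (hkj : k (c jf) = 2) (hk0 : ∀ l : Fin m, l ≠ jf → k (c l) = 0) :
    (∃ k'' : Fin s → ℤ, MoveEquiv B k k'' ∧ k'' (c jf.rev) = -2 ∧
        ∀ l : Fin m, l ≠ jf.rev → k'' (c l) = 0) ∧
    ((2 ≤ m ∧ ∀ i : Fin m, 0 < (i : ℕ) → (i : ℕ) + 1 < m →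
        ∀ v : Fin s,
          (∀ l : Fin m, ((l : ℕ) + 1 = (i : ℕ) ∨ l = i ∨ (i : ℕ) + 1 = (l : ℕ)) → v ≠ c l) →
          B (c i) v = 0) →
      ∃ k'' : Fin s → ℤ, MoveEquiv B k k'' ∧ k'' (c jf.rev) = -2 ∧
        (∀ l : Fin m, l ≠ jf.rev → k'' (c l) = 0) ∧
        ∀ v : Fin s, (∀ l : Fin m, v ≠ c l) →
          k'' v = k v + 2 * B v (c ⟨0, jf.pos⟩)
                    + 2 * B v (c ⟨m - 1, Nat.sub_lt jf.pos Nat.one_pos⟩)) := by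
  have hm := jf.pos
  obtain ⟨j, hj⟩ := jf
  set H : Prop := (2 ≤ m ∧ ∀ i : Fin m, 0 < (i : ℕ) → (i : ℕ) + 1 < m →
        ∀ v : Fin s,
          (∀ l : Fin m, ((l : ℕ) + 1 = (i : ℕ) ∨ l = i ∨ (i : ℕ) + 1 = (l : ℕ)) → v ≠ c l) →
          B (c i) v = 0) with hHdef
  have hH : H → 2 ≤ m ∧ ∀ i : Fin m, 0 < (i : ℕ) → (i : ℕ) + 1 < m →
        ∀ v : Fin s, (∀ l : Fin m, v ≠ c l) → B v (c i) = 0 := by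
    intro h
    refine ⟨h.1, fun i h0 h1 v hv => ?_⟩
    rw [hsymm]
    exact h.2 i h0 h1 v (fun l _ => hv l)
  -- the initial state
  have start : ChainInv B c hm k H (chainChi (j + 1) 0 (j + 1)) := by
    refine ⟨k, Relation.ReflTransGen.refl, ?_, ?_⟩
    · rintro ⟨l, hl⟩
      by_cases e : l = j
      · subst e
        rw [hkj]; simp [chainChi]
      · rw [hk0 ⟨l, hl⟩ (by simpa using e)]
        simp only [chainChi]
        split_ifs <;> first | omega | norm_num
    · intro _ v _
      have a1 : chainChi (j + 1) 0 (j + 1) 0 = 1 := by simp [chainChi]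
      have a2 : chainChi (j + 1) 0 (j + 1) m = 0 := by
        simp only [chainChi]; rw [if_neg]; omega
      rw [a1, a2]; ring
  -- moving the hole of the block to the left
  have inner : ∀ q, q + (j + 1) ≤ m → ChainInv B c hm k H (chainChi (j + 1) q (j + 1)) →
      ∀ d, d ≤ j + 1 → ChainInv B c hm k H (chainChi (j + 1) q (j + 1 - d)) := by
    intro q hq h0 d
    induction d with
    | zero => intro _; exact h0
    | succ d ih =>
      intro hd
      refine ChainInv.step B hsymm c hm hdiag hadj hfar k H hH _ _ (q + (j + 1 - (d + 1)))
        (by omega) ?_ ?_ ?_ ?_ ?_ (ih (by omega))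
      · simp only [chainChi]; rw [if_pos]; omega
      · simp only [chainChi]; rw [if_neg]; omega
      · simp only [chainChi]; rw [if_neg]; omega
      · simp only [chainChi]; rw [if_pos]; omega
      · intro t ht1 ht2
        simp only [chainChi]
        split_ifs <;> first | omega | rfl
  have outer : ∀ q, q + (j + 1) ≤ m → ChainInv B c hm k H (chainChi (j + 1) q (j + 1)) := by
    intro q
    induction q with
    | zero => intro _; exact start
    | succ q ih =>
      intro hq
      have h := inner q (by omega) (ih (by omega)) (j + 1) le_rfl
      have e : chainChi (j + 1) q (j + 1 - (j + 1)) = chainChi (j + 1) (q + 1) (j + 1) := by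
        funext t
        simp only [chainChi]
        split_ifs <;> first | omega | rfl
      rwa [e] at h
  have fin := inner (m - (j + 1)) (by omega) (outer _ (by omega)) (j + 1) le_rfl
  obtain ⟨k', hk, hc, hoff⟩ := fin
  have g1 : k' (c (Fin.rev ⟨j, hj⟩)) = -2 := by
    rw [hc]
    simp only [chainChi, Fin.val_rev]
    rw [if_neg (by omega), if_pos (by omega)]; norm_num
  have g2 : ∀ l : Fin m, l ≠ Fin.rev ⟨j, hj⟩ → k' (c l) = 0 := by
    rintro ⟨l, hl⟩ hne
    have hne' : l ≠ m - (j + 1) := by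
      intro e; apply hne; apply Fin.ext; simpa [Fin.val_rev] using e
    rw [hc]
    simp only [chainChi]
    split_ifs <;> first | omega | norm_num
  refine ⟨⟨k', hk, g1, g2⟩, fun hh => ⟨k', hk, g1, g2, fun v hv => ?_⟩⟩
  rw [hoff hh v hv]
  have a1 : chainChi (j + 1) (m - (j + 1)) (j + 1 - (j + 1)) 0 = 0 := by
    simp only [chainChi]; rw [if_neg]; omega
  have a2 : chainChi (j + 1) (m - (j + 1)) (j + 1 - (j + 1)) m = 1 := by
    simp only [chainChi]; rw [if_pos]; omega
  rw [a1, a2]; ring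
end

section
/- Let j ≥ 2 be an integer and let B_j, x be as specified. If k′ ∈ ℤ^{2j+3} is characteristic (k′ᵢ ≡ (B_j)ᵢᵢ mod 2 for all i), satisfies k′ · x = 0, and is a leaf representative for B_j, then k′ is equivalent (by a finite sequence of elementary moves for B_j) to a vector k″ such that k″ᵢ ≠ 0 for at least one index i with 5 ≤ i ≤ 2j+2. -/
/-- The intersection matrix `B_j` of the plumbing `Γ_j` of the 3-manifold `N_j`
(indices are `0`-indexed; the 1-indexed position is `(i : ℕ) + 1`). -/
def Bmat (j : ℕ) : Matrix (Fin (2 * j + 3)) (Fin (2 * j + 3)) ℤ :=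
  Matrix.of fun a b =>
    let p := (a : ℕ) + 1
    let q := (b : ℕ) + 1
    if p = q then
      if p = 1 then -1
      else if p = 2 then -2
      else if p = 3 then 1 - 8 * (j : ℤ)
      else if p = 4 then -3
      else if p = 2 * j + 3 then -5
      else -2
    else if (p = 1 ∧ (q = 2 ∨ q = 3 ∨ q = 4)) ∨ (q = 1 ∧ (p = 2 ∨ p = 3 ∨ p = 4)) then 1
    else if (4 ≤ p ∧ p + 1 = q) ∨ (4 ≤ q ∧ q + 1 = p) then 1
    else 0

/-- The generator `x` of the integer kernel of `B_j`. -/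
def xvec (j : ℕ) : Fin (2 * j + 3) → ℤ := fun a =>
  let p := (a : ℕ) + 1
  if p = 1 then 16 * (j : ℤ) - 2
  else if p = 2 then 8 * (j : ℤ) - 1
  else if p = 3 then 2
  else 8 * (j : ℤ) + 13 - 4 * (p : ℤ)

/-- Condition ★: `Bᵢᵢ ≤ kᵢ ≤ −Bᵢᵢ` for all `i`. -/
def SatStar {s : ℕ} (B : Matrix (Fin s) (Fin s) ℤ) (k : Fin s → ℤ) : Prop :=
  ∀ i : Fin s, B i i ≤ k i ∧ k i ≤ -B i i

/-- A leaf representative: every vector equivalent to `k` satisfies ★. -/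
def IsLeafRep {s : ℕ} (B : Matrix (Fin s) (Fin s) ℤ) (k : Fin s → ℤ) : Prop :=
  ∀ k' : Fin s → ℤ, MoveEquiv B k k' → SatStar B k'

/-- for `j ≥ 2`, a characteristic leaf representative `k'` for `B_j` orthogonal
to the kernel generator `x` is equivalent to a vector with a nonzero entry at some position
`i` with `5 ≤ i ≤ 2j+2` (1-indexed), i.e. on the `(−2)`-chain `Λ_j`. -/
theorem leaf_rep_nonzero_on_chain (j : ℕ) (hj : 2 ≤ j) (k : Fin (2 * j + 3) → ℤ)
    (hchar : ∀ i, (2 : ℤ) ∣ (k i - Bmat j i i))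
    (horth : ∑ i, k i * xvec j i = 0)
    (hleaf : IsLeafRep (Bmat j) k) :
    ∃ k'' : Fin (2 * j + 3) → ℤ, MoveEquiv (Bmat j) k k'' ∧
      ∃ i : Fin (2 * j + 3), 5 ≤ (i : ℕ) + 1 ∧ (i : ℕ) + 1 ≤ 2 * j + 2 ∧ k'' i ≠ 0 := by
  by_contra hno
  push Not at hno
  obtain ⟨i0, h0⟩ : ∃ i : Fin (2 * j + 3), (i : ℕ) = 0 := ⟨⟨0, by omega⟩, rfl⟩
  obtain ⟨i1, h1⟩ : ∃ i : Fin (2 * j + 3), (i : ℕ) = 1 := ⟨⟨1, by omega⟩, rfl⟩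
  obtain ⟨i3, h3⟩ : ∃ i : Fin (2 * j + 3), (i : ℕ) = 3 := ⟨⟨3, by omega⟩, rfl⟩
  obtain ⟨i4, h4⟩ : ∃ i : Fin (2 * j + 3), (i : ℕ) = 4 := ⟨⟨4, by omega⟩, rfl⟩
  have b00 : Bmat j i0 i0 = -1 := by
    simp only [Bmat, Matrix.of_apply, h0]; norm_num
  have b10 : Bmat j i1 i0 = 1 := by
    simp only [Bmat, Matrix.of_apply, h0, h1]; norm_num
  have b30 : Bmat j i3 i0 = 1 := by
    simp only [Bmat, Matrix.of_apply, h0, h3]; norm_num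
  have b01 : Bmat j i0 i1 = 1 := by
    simp only [Bmat, Matrix.of_apply, h0, h1]; norm_num
  have b11 : Bmat j i1 i1 = -2 := by
    simp only [Bmat, Matrix.of_apply, h1]; norm_num
  have b31 : Bmat j i3 i1 = 0 := by
    simp only [Bmat, Matrix.of_apply, h3, h1]; norm_num
  have b33 : Bmat j i3 i3 = -3 := by
    simp only [Bmat, Matrix.of_apply, h3]; norm_num
  have b43 : Bmat j i4 i3 = 1 := by
    simp only [Bmat, Matrix.of_apply, h3, h4]; norm_num
  have z : ∀ k'', MoveEquiv (Bmat j) k k'' → k'' i4 = 0 := fun k'' h =>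
    hno k'' h i4 (by omega) (by omega)
  -- `R a b d`: some equivalent vector has entries `a, b, d` at positions 1, 2, 4.
  let R : ℤ → ℤ → ℤ → Prop := fun a b d =>
    ∃ k'', MoveEquiv (Bmat j) k k'' ∧ k'' i0 = a ∧ k'' i1 = b ∧ k'' i3 = d
  have up0 : ∀ b d, R 1 b d → R (-1) (b + 2) (d + 2) := by
    rintro b d ⟨k', hk, ha, hb, hd⟩
    refine ⟨_, hk.tail ⟨i0, Or.inl ⟨by rw [ha, b00]; rfl, rfl⟩⟩, ?_, ?_, ?_⟩ <;>
      simp only [b00, b10, b30, ha, hb, hd] <;> ring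
  have dn0 : ∀ b d, R (-1) b d → R 1 (b - 2) (d - 2) := by
    rintro b d ⟨k', hk, ha, hb, hd⟩
    refine ⟨_, hk.tail ⟨i0, Or.inr ⟨by rw [ha, b00], rfl⟩⟩, ?_, ?_, ?_⟩ <;>
      simp only [b00, b10, b30, ha, hb, hd] <;> ring
  have up1 : ∀ a d, R a 2 d → R (a + 2) (-2) d := by
    rintro a d ⟨k', hk, ha, hb, hd⟩
    refine ⟨_, hk.tail ⟨i1, Or.inl ⟨by rw [hb, b11]; rfl, rfl⟩⟩, ?_, ?_, ?_⟩ <;>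
      simp only [b01, b11, b31, ha, hb, hd] <;> ring
  have dn1 : ∀ a d, R a (-2) d → R (a - 2) 2 d := by
    rintro a d ⟨k', hk, ha, hb, hd⟩
    refine ⟨_, hk.tail ⟨i1, Or.inr ⟨by rw [hb, b11], rfl⟩⟩, ?_, ?_, ?_⟩ <;>
      simp only [b01, b11, b31, ha, hb, hd] <;> ring
  have n3 : ∀ a b, ¬ R a b 3 := by
    rintro a b ⟨k', hk, ha, hb, hd⟩
    have e := z _ (hk.tail ⟨i3, Or.inl ⟨by rw [hd, b33]; rfl, rfl⟩⟩)
    simp only [b43, z _ hk] at e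
    omega
  have n3' : ∀ a b, ¬ R a b (-3) := by
    rintro a b ⟨k', hk, ha, hb, hd⟩
    have e := z _ (hk.tail ⟨i3, Or.inr ⟨by rw [hd, b33], rfl⟩⟩)
    simp only [b43, z _ hk] at e
    omega
  have bd : ∀ a b d, R a b d → -2 ≤ b ∧ b ≤ 2 := by
    rintro a b d ⟨k', hk, ha, hb, hd⟩
    have := hleaf k' hk i1
    rw [b11, hb] at this
    omega
  have start : R (k i0) (k i1) (k i3) := ⟨k, Relation.ReflTransGen.refl, rfl, rfl, rfl⟩
  have s := hleaf k Relation.ReflTransGen.refl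
  have s0 := s i0
  have s1 := s i1
  have s3 := s i3
  have c0 := hchar i0
  have c1 := hchar i1
  have c3 := hchar i3
  rw [b00] at s0 c0
  rw [b11] at s1 c1
  rw [b33] at s3 c3
  generalize k i0 = a at *
  generalize k i1 = b at *
  generalize k i3 = d at *
  have hd : d = 1 ∨ d = -1 := by
    have : d ≠ 3 := by rintro rfl; exact n3 _ _ start
    have : d ≠ -3 := by rintro rfl; exact n3' _ _ start
    omega
  have ha : a = 1 ∨ a = -1 := by omega
  have hb : b = -2 ∨ b = 0 ∨ b = 2 := by omega
  rcases ha with rfl | rfl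
  · have r1 := up0 _ _ start
    rcases hd with rfl | rfl
    · exact n3 _ _ r1
    · rcases hb with rfl | rfl | rfl
      · exact n3' _ _ (dn0 _ _ (dn1 _ _ start))
      · exact n3 _ _ (up0 _ _ (up1 _ _ r1))
      · have := bd _ _ _ r1
        omega
  · have r1 := dn0 _ _ start
    rcases hd with rfl | rfl
    · rcases hb with rfl | rfl | rfl
      · have := bd _ _ _ r1
        omega
      · exact n3' _ _ (dn0 _ _ (dn1 _ _ r1))
      · exact n3 _ _ (up0 _ _ (up1 _ _ start))
    · exact n3' _ _ r1
end

section
/- Let j ≥ 1 be an integer and let B_j, x be as specified. If k′ ∈ ℤ^{2j+3} is characteristic (k′ᵢ ≡ (B_j)ᵢᵢ mod 2 for all i), satisfies k′ · x = 0, and is a leaf representative for B_j, then k′ is equivalent (by a finite sequence of elementary moves for B_j) to k₁ = (−1, 0, 5−4j, 3, 0, …, 0, −3) or to k₂ = (−1, 0, 3−4j, 3, 0, …, 0, 1), where in each vector the entries in positions 5 through 2j+2 are zero. -/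
set_option linter.all false

/-- The leaf vector `k₁ = (−1, 0, 5−4j, 3, 0, …, 0, −3)`. -/
def k1vec (j : ℕ) : Fin (2 * j + 3) → ℤ := fun a =>
  let p := (a : ℕ) + 1
  if p = 1 then -1
  else if p = 2 then 0
  else if p = 3 then 5 - 4 * (j : ℤ)
  else if p = 4 then 3
  else if p = 2 * j + 3 then -3
  else 0

/-- The leaf vector `k₂ = (−1, 0, 3−4j, 3, 0, …, 0, 1)`. -/
def k2vec (j : ℕ) : Fin (2 * j + 3) → ℤ := fun a =>
  let p := (a : ℕ) + 1
  if p = 1 then -1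
  else if p = 2 then 0
  else if p = 3 then 3 - 4 * (j : ℤ)
  else if p = 4 then 3
  else if p = 2 * j + 3 then 1
  else 0

/-- The entries of `Bmat j`, indexed by natural numbers. -/
def Bn (j a b : ℕ) : ℤ :=
  if a = b then
    if a = 0 then -1
    else if a = 1 then -2
    else if a = 2 then 1 - 8 * (j : ℤ)
    else if a = 3 then -3
    else if a = 2 * j + 2 then -5
    else -2
  else if (a = 0 ∧ (b = 1 ∨ b = 2 ∨ b = 3)) ∨ (b = 0 ∧ (a = 1 ∨ a = 2 ∨ a = 3)) then 1
  else if (3 ≤ a ∧ a + 1 = b) ∨ (3 ≤ b ∧ b + 1 = a) then 1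
  else 0

/-- The entries of `xvec j`, indexed by natural numbers. -/
def xn (j a : ℕ) : ℤ :=
  if a = 0 then 16 * (j : ℤ) - 2
  else if a = 1 then 8 * (j : ℤ) - 1
  else if a = 2 then 2
  else 8 * (j : ℤ) + 9 - 4 * (a : ℤ)

lemma Bmat_eq (j : ℕ) (a b : Fin (2 * j + 3)) : Bmat j a b = Bn j a b := by
  simp only [Bmat, Bn, Matrix.of_apply]
  split_ifs <;> first | rfl | omega

lemma xvec_eq (j : ℕ) (a : Fin (2 * j + 3)) : xvec j a = xn j a := by
  simp only [xvec, xn]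
  split_ifs <;> first | rfl | omega | (push_cast; ring)

lemma elemMove_symm (j : ℕ) (k k' : Fin (2 * j + 3) → ℤ)
    (h : IsElemMove (Bmat j) k k') : IsElemMove (Bmat j) k' k := by
  obtain ⟨i, ⟨h1, h2⟩ | ⟨h1, h2⟩⟩ := h
  · refine ⟨i, Or.inr ⟨?_, ?_⟩⟩
    · rw [h2]; simp only; omega
    · rw [h2]; funext v; simp only; omega
  · refine ⟨i, Or.inl ⟨?_, ?_⟩⟩
    · rw [h2]; simp only; omega
    · rw [h2]; funext v; simp only; omega

lemma moveEquiv_symm (j : ℕ) (k k' : Fin (2 * j + 3) → ℤ)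
    (h : MoveEquiv (Bmat j) k k') : MoveEquiv (Bmat j) k' k := by
  induction h with
  | refl => exact Relation.ReflTransGen.refl
  | tail _ h2 ih => exact Relation.ReflTransGen.head (elemMove_symm j _ _ h2) ih

/-- Equivalence of natural-number-indexed vectors after restriction. -/
def NRel (j : ℕ) (K K' : ℕ → ℤ) : Prop :=
  MoveEquiv (Bmat j) (fun i : Fin (2 * j + 3) => K i) (fun i : Fin (2 * j + 3) => K' i)

lemma NRel.symm {j : ℕ} {K K' : ℕ → ℤ} (h : NRel j K K') : NRel j K' K := moveEquiv_symm _ _ _ h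

lemma NRel.trans {j : ℕ} {K K' K'' : ℕ → ℤ} (h : NRel j K K') (h' : NRel j K' K'') : NRel j K K'' :=
  Relation.ReflTransGen.trans h h'

lemma NRel.of_eq {j : ℕ} {K K' : ℕ → ℤ} (h : ∀ v, v < 2 * j + 3 → K v = K' v) : NRel j K K' := by
  have : (fun i : Fin (2 * j + 3) => K i) = (fun i : Fin (2 * j + 3) => K' i) := by
    funext i; exact h i i.2
  unfold NRel; rw [this]; exact Relation.ReflTransGen.refl

lemma flip_pos {j : ℕ} (K : ℕ → ℤ) (i : ℕ) (hi : i < 2 * j + 3) (h : K i = - Bn j i i) :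
    NRel j K (fun v => K v + 2 * Bn j v i) := by
  refine Relation.ReflTransGen.single ⟨⟨i, hi⟩, Or.inl ⟨?_, ?_⟩⟩
  · rw [Bmat_eq]; exact h
  · funext v; rw [Bmat_eq]

lemma flip_neg {j : ℕ} (K : ℕ → ℤ) (i : ℕ) (hi : i < 2 * j + 3) (h : K i = Bn j i i) :
    NRel j K (fun v => K v - 2 * Bn j v i) := by
  refine Relation.ReflTransGen.single ⟨⟨i, hi⟩, Or.inr ⟨?_, ?_⟩⟩
  · rw [Bmat_eq]; exact h
  · funext v; rw [Bmat_eq]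

/-- The kernel relation `B x = 0`. -/
lemma Bx_zero (j : ℕ) (hj : 1 ≤ j) (i : ℕ) (hi : i < 2 * j + 3) :
    ∑ v ∈ Finset.range (2 * j + 3), Bn j v i * xn j v = 0 := by
  have key : ∀ s : Finset ℕ, s ⊆ Finset.range (2 * j + 3) → (∀ v, v < 2 * j + 3 → v ∉ s → Bn j v i = 0) →
      ∑ v ∈ s, Bn j v i * xn j v = 0 →
      ∑ v ∈ Finset.range (2 * j + 3), Bn j v i * xn j v = 0 := by
    intro s hs h0 h
    rw [← h]; symm
    apply Finset.sum_subset hs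
    intro v hv' hv
    rw [h0 v (Finset.mem_range.1 hv') hv, zero_mul]
  by_cases h0 : i = 0
  · subst h0
    apply key {0, 1, 2, 3}
    · intro v; simp; omega
    · intro v _; simp [Bn]; omega
    · simp [Bn, xn]; ring
  by_cases h1 : i = 1
  · subst h1
    apply key {0, 1}
    · intro v; simp; omega
    · intro v _; simp [Bn]; omega
    · simp [Bn, xn]; ring
  by_cases h2 : i = 2
  · subst h2
    apply key {0, 2}
    · intro v; simp; omega
    · intro v _; simp [Bn]; omega
    · simp [Bn, xn]; ring
  by_cases h3 : i = 3
  · subst h3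
    apply key {0, 3, 4}
    · intro v; simp; omega
    · intro v _; simp [Bn]; omega
    · simp [Bn, xn]; ring
  by_cases h4 : i = 2 * j + 2
  · subst h4
    apply key {2 * j + 1, 2 * j + 2}
    · intro v; simp; omega
    · intro v hv3; simp only [Finset.mem_insert, Finset.mem_singleton, Bn]; intro hv
      split_ifs <;> first | contradiction | omega | grind
    · rw [Finset.sum_pair (by omega)]
      have e1 : Bn j (2 * j + 1) (2 * j + 2) = 1 := by simp [Bn]; omega
      have e2 : Bn j (2 * j + 2) (2 * j + 2) = -5 := by simp only [Bn]; split_ifs <;> first | contradiction | omega | grind | (simp_all; done)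
      have e3 : xn j (2 * j + 1) = 5 := by
        simp only [xn]; split_ifs <;> first | contradiction | omega | (push_cast; ring)
      have e4 : xn j (2 * j + 2) = 1 := by
        simp only [xn]; split_ifs <;> first | contradiction | omega | (push_cast; ring)
      rw [e1, e2, e3, e4]; norm_num
  · obtain ⟨m, rfl⟩ : ∃ m, i = m + 1 := ⟨i - 1, by omega⟩
    apply key {m, m + 1, m + 2}
    · intro v; simp; omega
    · intro v _; simp [Bn]; omega
    · rw [Finset.sum_insert (by simp), Finset.sum_pair (by omega)]
      have e1 : Bn j m (m + 1) = 1 := by simp [Bn]; omega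
      have e2 : Bn j (m + 1) (m + 1) = -2 := by simp [Bn]; omega
      have e2' : Bn j (m + 2) (m + 1) = 1 := by simp [Bn]; omega
      have e3 : xn j m = 8 * j + 9 - 4 * m := by
        simp only [xn]; split_ifs <;> first | contradiction | omega | (push_cast; ring)
      have e4 : xn j (m + 1) = 8 * j + 5 - 4 * m := by
        simp only [xn]; split_ifs <;> first | contradiction | omega | (push_cast; ring)
      have e5 : xn j (m + 2) = 8 * j + 1 - 4 * m := by
        simp only [xn]; split_ifs <;> first | contradiction | omega | (push_cast; ring)
      rw [e1, e2, e2', e3, e4, e5]; ring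

lemma Bx_zero_fin (j : ℕ) (hj : 1 ≤ j) (i : Fin (2 * j + 3)) :
    ∑ v, Bmat j v i * xvec j v = 0 := by
  have := Bx_zero j hj i i.2
  rw [← Fin.sum_univ_eq_sum_range (fun v => Bn j v i * xn j v)] at this
  rw [← this]
  refine Finset.sum_congr rfl fun v _ => ?_
  rw [Bmat_eq, xvec_eq]

/-- The hypotheses of the theorem. -/
def Good (j : ℕ) (k : Fin (2 * j + 3) → ℤ) : Prop :=
  (∀ i, (2 : ℤ) ∣ (k i - Bmat j i i)) ∧ (∑ i, k i * xvec j i = 0) ∧ IsLeafRep (Bmat j) k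

lemma Good.move {j : ℕ} (hj : 1 ≤ j) {k k' : Fin (2 * j + 3) → ℤ} (hg : Good j k)
    (h : MoveEquiv (Bmat j) k k') : Good j k' := by
  induction h with
  | refl => exact hg
  | @tail b c _ h2 ih =>
    obtain ⟨g1, g2, g3⟩ := ih
    refine ⟨?_, ?_, fun k'' hk => g3 k'' (Relation.ReflTransGen.head h2 hk)⟩
    · obtain ⟨i, ⟨_, rfl⟩ | ⟨_, rfl⟩⟩ := h2
      · intro v; have := g1 v; simp only; omega
      · intro v; have := g1 v; simp only; omega
    · obtain ⟨i, ⟨_, rfl⟩ | ⟨_, rfl⟩⟩ := h2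
      · have e : ∑ v, (b v + 2 * Bmat j v i) * xvec j v
            = ∑ v, b v * xvec j v + 2 * ∑ v, Bmat j v i * xvec j v := by
          rw [Finset.mul_sum, ← Finset.sum_add_distrib]
          exact Finset.sum_congr rfl fun v _ => by ring
        rw [e, g2, Bx_zero_fin j hj]; norm_num
      · have e : ∑ v, (b v - 2 * Bmat j v i) * xvec j v
            = ∑ v, b v * xvec j v - 2 * ∑ v, Bmat j v i * xvec j v := by
          rw [Finset.mul_sum, ← Finset.sum_sub_distrib]
          exact Finset.sum_congr rfl fun v _ => by ring
        rw [e, g2, Bx_zero_fin j hj]; norm_num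

/-- `Good` for natural-number-indexed vectors. -/
def GoodN (j : ℕ) (K : ℕ → ℤ) : Prop := Good j (fun i : Fin (2 * j + 3) => K i)

lemma GoodN.rel {j : ℕ} (hj : 1 ≤ j) {K K' : ℕ → ℤ} (hg : GoodN j K) (h : NRel j K K') :
    GoodN j K' := Good.move hj hg h

lemma GoodN.star {j : ℕ} {K : ℕ → ℤ} (hg : GoodN j K) (i : ℕ) (hi : i < 2 * j + 3) :
    Bn j i i ≤ K i ∧ K i ≤ - Bn j i i ∧ (2 : ℤ) ∣ (K i - Bn j i i) := by
  obtain ⟨g1, -, g3⟩ := hg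
  have a := g1 ⟨i, hi⟩
  have b := g3 _ Relation.ReflTransGen.refl ⟨i, hi⟩
  rw [Bmat_eq] at a b
  exact ⟨b.1, b.2, a⟩

/-- Macro move at the central vertices. -/
lemma macroA {j : ℕ} (hj : 1 ≤ j) (K : ℕ → ℤ) (h0 : K 0 = -1) (h1 : K 1 = 0) :
    NRel j K (fun v => K v +
      (if v = 0 then 2 else if v = 2 then -4 else if v = 3 then -4 else 0)) := by
  refine (flip_neg K 0 (by omega) (by simp [Bn, h0])).trans ?_
  refine (flip_neg _ 1 (by omega) (by simp [Bn, h1])).trans ?_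
  refine (flip_neg _ 0 (by omega) (by simp [Bn, h0])).trans ?_
  refine NRel.of_eq fun v hv => ?_
  simp only [Bn]
  split_ifs <;> first | contradiction | omega | grind | (simp_all; done)

/-- The macro move pushing along the chain. -/
lemma macroP {j : ℕ} (hj : 1 ≤ j) (p : ℕ) (hp : 3 ≤ p) : p < 2 * j + 2 → ∀ (K : ℕ → ℤ),
    K 0 = -1 → K 1 = 0 → K 3 = 3 → (∀ v, 4 ≤ v → v ≤ p → K v = 0) →
    NRel j K (fun v => K v +
      (if v = 2 then 4 else if v = p then -2 else if v = p + 1 then 2 else 0)) := by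
  induction p, hp using Nat.le_induction with
  | base =>
    intro hp K h0 h1 h3 _
    refine (flip_pos K 3 (by omega) (by simp [Bn, h3])).trans ?_
    refine (flip_pos _ 0 (by omega) (by simp [Bn, h0])).trans ?_
    refine (flip_pos _ 1 (by omega) (by simp [Bn, h1])).trans ?_
    refine (flip_pos _ 0 (by omega) (by simp [Bn, h0])).trans ?_
    refine NRel.of_eq fun v hv => ?_
    simp only [Bn]
    split_ifs <;> first | contradiction | omega | grind | (simp_all; done)
  | succ p hp ih =>
    intro hp' K h0 h1 h3 hz
    refine (ih (by omega) K h0 h1 h3 (fun v hv hv' => hz v hv (by omega))).trans ?_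
    have hp1 := hz (p + 1) (by omega) le_rfl
    refine (flip_pos _ (p + 1) (by omega) ?_).trans ?_
    · simp only [Bn, hp1]
      split_ifs <;> first | contradiction | omega | grind | (simp_all; done)
    refine NRel.of_eq fun v hv => ?_
    simp only [Bn]
    split_ifs <;> first | contradiction | omega | grind | (simp_all; done)

lemma norm0 {j : ℕ} (hj : 1 ≤ j) (K : ℕ → ℤ) (hg : GoodN j K) :
    ∃ K', NRel j K K' ∧ K' 0 = -1 := by
  have hs := hg.star 0 (by omega)
  simp only [Bn, if_true] at hs
  by_cases h : K 0 = -1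
  · exact ⟨K, NRel.of_eq fun _ _ => rfl, h⟩
  · exact ⟨_, flip_pos K 0 (by omega) (by simp [Bn]; omega), by simp [Bn]; omega⟩

lemma norm1 {j : ℕ} (hj : 1 ≤ j) (K : ℕ → ℤ) (hg : GoodN j K) (h0 : K 0 = -1) :
    ∃ K', NRel j K K' ∧ K' 0 = -1 ∧ K' 1 = 0 := by
  have hs := hg.star 1 (by omega)
  have r := flip_neg (j := j) K 0 (by omega) (by simp [Bn, h0])
  have hs' := (hg.rel hj r).star 1 (by omega)
  simp [Bn] at hs hs'
  by_cases h : K 1 = 0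
  · exact ⟨K, NRel.of_eq fun _ _ => rfl, h0, h⟩
  · have h2 : K 1 = 2 := by omega
    refine ⟨_, (flip_pos K 1 (by omega) (by simp [Bn, h2])).trans
      (flip_pos _ 0 (by omega) (by simp [Bn, h0])), ?_, ?_⟩
    · simp [Bn, h0]
    · simp [Bn, h2]

lemma norm3 {j : ℕ} (hj : 1 ≤ j) (K : ℕ → ℤ) (hg : GoodN j K) (h0 : K 0 = -1) (h1 : K 1 = 0) :
    ∃ K', NRel j K K' ∧ K' 0 = -1 ∧ K' 1 = 0 ∧ K' 3 = 3 := by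
  have hs := hg.star 3 (by omega)
  have hs' := (hg.rel hj (macroA hj K h0 h1)).star 3 (by omega)
  simp [Bn] at hs hs'
  by_cases h : K 3 = 3
  · exact ⟨K, NRel.of_eq fun _ _ => rfl, h0, h1, h⟩
  · have h2 : K 3 = 1 := by omega
    refine ⟨fun v => K v - (if v = 2 then 4 else if v = 3 then -2 else if v = 4 then 2 else 0),
      NRel.symm ?_, by simp [h0], by simp [h1], by simp [h2]⟩
    refine (macroP hj 3 le_rfl (by omega) _ (by simp [h0]) (by simp [h1]) (by simp [h2])
      (fun v _ _ => by omega)).trans ?_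
    refine NRel.of_eq fun v hv => ?_
    simp

lemma normChain {j : ℕ} (hj : 1 ≤ j) (K : ℕ → ℤ) (hg : GoodN j K) (h0 : K 0 = -1) (h1 : K 1 = 0)
    (h3 : K 3 = 3) (p : ℕ) (hp : 3 ≤ p) : p < 2 * j + 2 →
    ∃ K', NRel j K K' ∧ K' 0 = -1 ∧ K' 1 = 0 ∧ K' 3 = 3 ∧ ∀ v, 4 ≤ v → v ≤ p → K' v = 0 := by
  induction p, hp using Nat.le_induction with
  | base =>
    intro _
    exact ⟨K, NRel.of_eq fun _ _ => rfl, h0, h1, h3, fun v _ _ => by omega⟩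
  | succ p hp ih =>
    intro hp'
    obtain ⟨L, r, l0, l1, l3, lz⟩ := ih (by omega)
    have hgL := hg.rel hj r
    have hs := hgL.star (p + 1) (by omega)
    have hs' := (hgL.rel hj (macroP hj p hp (by omega) L l0 l1 l3 lz)).star (p + 1) (by omega)
    have hb : Bn j (p + 1) (p + 1) = -2 := by simp only [Bn]; split_ifs <;> first | contradiction | omega | grind | (simp_all; done)
    rw [hb] at hs hs'
    have e : (if p + 1 = 2 then (4 : ℤ) else if p + 1 = p then -2
        else if p + 1 = p + 1 then 2 else 0) = 2 := by split_ifs <;> first | contradiction | omega | grind | (simp_all; done)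
    beta_reduce at hs'
    rw [e] at hs'
    by_cases h : L (p + 1) = 0
    · refine ⟨L, r, l0, l1, l3, fun v hv hv' => ?_⟩
      rcases Nat.lt_or_ge p v with h' | h'
      · rw [show v = p + 1 by omega]; exact h
      · exact lz v hv h'
    · have h2 : L (p + 1) = -2 := by omega
      have z : ∀ v, 4 ≤ v → v ≤ p + 1 → L v - (if v = 2 then 4 else if v = p + 1 then -2
          else if v = p + 1 + 1 then 2 else 0) = 0 := by
        intro v hv hv'
        rcases Nat.lt_or_ge p v with h' | h'
        · obtain rfl : v = p + 1 := by omega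
          rw [h2]; split_ifs <;> first | contradiction | omega | grind | (simp_all; done)
        · rw [lz v hv h']; split_ifs <;> first | contradiction | omega | grind | (simp_all; done)
      have z0 : L 0 - (if 0 = 2 then 4 else if 0 = p + 1 then -2
          else if 0 = p + 1 + 1 then 2 else 0) = -1 := by
        rw [l0]; split_ifs <;> first | contradiction | omega | grind | (simp_all; done)
      have z1 : L 1 - (if 1 = 2 then 4 else if 1 = p + 1 then -2
          else if 1 = p + 1 + 1 then 2 else 0) = 0 := by
        rw [l1]; split_ifs <;> first | contradiction | omega | grind | (simp_all; done)
      have z3 : L 3 - (if 3 = 2 then 4 else if 3 = p + 1 then -2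
          else if 3 = p + 1 + 1 then 2 else 0) = 3 := by
        rw [l3]; split_ifs <;> first | contradiction | omega | grind | (simp_all; done)
      refine ⟨fun v => L v - (if v = 2 then 4 else if v = p + 1 then -2
        else if v = p + 1 + 1 then 2 else 0), r.trans (NRel.symm ?_), z0, z1, z3, z⟩
      refine (macroP hj (p + 1) (by omega) hp' _ z0 z1 z3 z).trans ?_
      refine NRel.of_eq fun v hv => ?_
      simp

lemma orth_normal {j : ℕ} (hj : 1 ≤ j) (K : ℕ → ℤ) (hg : GoodN j K) (h0 : K 0 = -1) (h1 : K 1 = 0)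
    (h3 : K 3 = 3) (hz : ∀ v, 4 ≤ v → v ≤ 2 * j + 1 → K v = 0) :
    8 * (j : ℤ) - 7 + 2 * K 2 + K (2 * j + 2) = 0 := by
  obtain ⟨-, g2, -⟩ := hg
  have e : ∑ i : Fin (2 * j + 3), K i * xvec j i
      = ∑ v ∈ Finset.range (2 * j + 3), K v * xn j v := by
    rw [← Fin.sum_univ_eq_sum_range (fun v => K v * xn j v)]
    exact Finset.sum_congr rfl fun v _ => by rw [xvec_eq]
  rw [e] at g2
  have hs : ({0, 1, 2, 3, 2 * j + 2} : Finset ℕ) ⊆ Finset.range (2 * j + 3) := by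
    intro v; simp; omega
  rw [← Finset.sum_subset hs] at g2
  · rw [Finset.sum_insert (by simp), Finset.sum_insert (by simp <;> omega),
      Finset.sum_insert (by simp <;> omega), Finset.sum_pair (by omega), h0, h1, h3] at g2
    have e4 : xn j (2 * j + 2) = 1 := by
      simp only [xn]; split_ifs <;> first | contradiction | omega | (push_cast; ring)
    rw [e4] at g2
    simp [xn] at g2
    linarith
  · intro v hv hv'
    simp at hv hv'
    rw [hz v (by omega) (by omega), zero_mul]

/-- for `j ≥ 1`, every characteristic leaf representative for `B_j` orthogonal
to the kernel generator `x` is equivalent (by elementary moves for `B_j`) to `k₁` or to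
`k₂`. -/
theorem leaf_rep_equiv_k1_or_k2 (j : ℕ) (hj : 1 ≤ j) (k : Fin (2 * j + 3) → ℤ)
    (hchar : ∀ i, (2 : ℤ) ∣ (k i - Bmat j i i))
    (horth : ∑ i, k i * xvec j i = 0)
    (hleaf : IsLeafRep (Bmat j) k) :
    MoveEquiv (Bmat j) k (k1vec j) ∨ MoveEquiv (Bmat j) k (k2vec j) := by
  have hg : GoodN j (fun v => if h : v < 2 * j + 3 then k ⟨v, h⟩ else 0) := by
    have : (fun i : Fin (2 * j + 3) => (fun v => if h : v < 2 * j + 3 then k ⟨v, h⟩ else 0) (i : ℕ))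
        = k := by funext i; simp
    unfold GoodN
    rw [this]
    exact ⟨hchar, horth, hleaf⟩
  have hk : (fun i : Fin (2 * j + 3) => (fun v => if h : v < 2 * j + 3 then k ⟨v, h⟩ else 0) (i : ℕ))
      = k := by funext i; simp
  obtain ⟨K0, r0, a0⟩ := norm0 hj _ hg
  obtain ⟨K1, r1, b0, b1⟩ := norm1 hj K0 (hg.rel hj r0) a0
  have r01 := r0.trans r1
  obtain ⟨K3, r3, c0, c1, c3⟩ := norm3 hj K1 (hg.rel hj r01) b0 b1
  have r03 := r01.trans r3
  obtain ⟨K, r, d0, d1, d3, dz⟩ :=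
    normChain hj K3 (hg.rel hj r03) c0 c1 c3 (2 * j + 1) (by omega) (by omega)
  have rr := r03.trans r
  have hgK := hg.rel hj rr
  have ho := orth_normal hj K hgK d0 d1 d3 dz
  have hs := hgK.star (2 * j + 2) (by omega)
  have hs' := (hgK.rel hj (macroP hj (2 * j + 1) (by omega) (by omega) K d0 d1 d3 dz)).star
    (2 * j + 2) (by omega)
  have hb : Bn j (2 * j + 2) (2 * j + 2) = -5 := by simp only [Bn]; split_ifs <;> first | contradiction | omega | grind | (simp_all; done)
  have e : (if 2 * j + 2 = 2 then (4 : ℤ) else if 2 * j + 2 = 2 * j + 1 then -2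
      else if 2 * j + 2 = 2 * j + 1 + 1 then 2 else 0) = 2 := by split_ifs <;> first | contradiction | omega | grind | (simp_all; done)
  beta_reduce at hs'
  rw [e] at hs'
  rw [hb] at hs hs'
  have h2 := hgK.star 2 (by omega)
  simp [Bn] at h2
  unfold NRel at rr
  rw [hk] at rr
  have hcase : K (2 * j + 2) = -3 ∨ K (2 * j + 2) = 1 := by omega
  rcases hcase with hc | hc
  · left
    have : (fun i : Fin (2 * j + 3) => K i) = k1vec j := by
      funext ⟨i, hi⟩
      simp only [k1vec]
      by_cases i0 : i = 0
      · subst i0; simp [d0]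
      by_cases i1 : i = 1
      · subst i1; simp [d1]
      by_cases i2 : i = 2
      · subst i2; simp; omega
      by_cases i3 : i = 3
      · subst i3; simp [d3]
      by_cases i4 : i = 2 * j + 2
      · subst i4; rw [hc]; split_ifs <;> first | contradiction | omega | grind | (simp_all; done)
      · rw [dz i (by omega) (by omega)]; split_ifs <;> first | contradiction | omega | grind | (simp_all; done)
    rw [← this]; exact rr
  · right
    have : (fun i : Fin (2 * j + 3) => K i) = k2vec j := by
      funext ⟨i, hi⟩
      simp only [k2vec]
      by_cases i0 : i = 0
      · subst i0; simp [d0]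
      by_cases i1 : i = 1
      · subst i1; simp [d1]
      by_cases i2 : i = 2
      · subst i2; simp; omega
      by_cases i3 : i = 3
      · subst i3; simp [d3]
      by_cases i4 : i = 2 * j + 2
      · subst i4; rw [hc]; split_ifs <;> first | contradiction | omega | grind | (simp_all; done)
      · rw [dz i (by omega) (by omega)]; split_ifs <;> first | contradiction | omega | grind | (simp_all; done)
    rw [← this]; exact rr
end

section
/- Let j ≥ 1 be an integer and let B_j, x be as specified. Then B_j is negative semi-definite, i.e. vᵀ B_j v ≤ 0 for every v ∈ ℚ^{2j+3}, and the integer kernel of B_j is exactly the subgroup generated by x: {v ∈ ℤ^{2j+3} : B_j v = 0} = ℤ·x. -/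
/-- A symmetric matrix with nonnegative off-diagonal entries and a positive kernel vector is
negative semidefinite. -/
lemma negSemidef_aux {n : ℕ} (B : Fin n → Fin n → ℚ) (x : Fin n → ℚ)
    (hs : ∀ a b, B a b = B b a) (hoff : ∀ a b, a ≠ b → 0 ≤ B a b)
    (hx : ∀ a, 0 < x a) (hk : ∀ a, ∑ b, B a b * x b = 0) (v : Fin n → ℚ) :
    ∑ a, ∑ b, v a * B a b * v b ≤ 0 := by
  have key : ∀ a b, v a * B a b * v b =
      (v a ^ 2 / x a) * (B a b * x b) / 2 + (v b ^ 2 / x b) * (B b a * x a) / 2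
        - B a b * (x a * x b * (v a / x a - v b / x b) ^ 2) / 2 := by
    intro a b
    have h1 := (hx a).ne'
    have h2 := (hx b).ne'
    rw [hs b a]
    field_simp
    ring
  have e1 : ∑ a, ∑ b, (v a ^ 2 / x a) * (B a b * x b) / 2 = 0 := by
    apply Finset.sum_eq_zero
    intro a _
    rw [← Finset.sum_div, ← Finset.mul_sum, hk]
    simp
  have e2 : ∑ a, ∑ b, (v b ^ 2 / x b) * (B b a * x a) / 2 = 0 := by
    rw [Finset.sum_comm]
    exact e1
  have e3 : 0 ≤ ∑ a, ∑ b, B a b * (x a * x b * (v a / x a - v b / x b) ^ 2) / 2 := by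
    refine Finset.sum_nonneg fun a _ => Finset.sum_nonneg fun b _ => ?_
    by_cases h : a = b
    · subst h; simp
    · have := hoff a b h
      have h1 := hx a
      have h2 := hx b
      positivity
  simp_rw [key, Finset.sum_sub_distrib, Finset.sum_add_distrib]
  rw [e1, e2]
  linarith

lemma row_zero (j : ℕ) (hj : 1 ≤ j) (v : Fin (2 * j + 3) → ℤ) :
    (Bmat j).mulVec v ⟨0, by omega⟩ =
      -v ⟨0, by omega⟩ + v ⟨1, by omega⟩ + v ⟨2, by omega⟩ + v ⟨3, by omega⟩ := by
  have h : ∀ b : Fin (2 * j + 3), Bmat j ⟨0, by omega⟩ b * v b =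
      (if b = ⟨0, by omega⟩ then - v b else 0) + (if b = ⟨1, by omega⟩ then v b else 0)
      + (if b = ⟨2, by omega⟩ then v b else 0) + (if b = ⟨3, by omega⟩ then v b else 0) := by
    intro b
    simp only [Bmat, Matrix.of_apply, Fin.ext_iff]
    split_ifs <;> first | omega | (simp; done) | simp_all
  simp only [Matrix.mulVec, dotProduct, h, Finset.sum_add_distrib, Finset.sum_ite_eq',
    Finset.mem_univ, if_true]

lemma row_one (j : ℕ) (hj : 1 ≤ j) (v : Fin (2 * j + 3) → ℤ) :
    (Bmat j).mulVec v ⟨1, by omega⟩ = v ⟨0, by omega⟩ + -2 * v ⟨1, by omega⟩ := by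
  have h : ∀ b : Fin (2 * j + 3), Bmat j ⟨1, by omega⟩ b * v b =
      (if b = ⟨0, by omega⟩ then v b else 0) + (if b = ⟨1, by omega⟩ then -2 * v b else 0) := by
    intro b
    simp only [Bmat, Matrix.of_apply, Fin.ext_iff]
    split_ifs <;> first | omega | (simp; done) | simp_all
  simp only [Matrix.mulVec, dotProduct, h, Finset.sum_add_distrib, Finset.sum_ite_eq',
    Finset.mem_univ, if_true]

lemma row_two (j : ℕ) (hj : 1 ≤ j) (v : Fin (2 * j + 3) → ℤ) :
    (Bmat j).mulVec v ⟨2, by omega⟩ =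
      v ⟨0, by omega⟩ + (1 - 8 * (j : ℤ)) * v ⟨2, by omega⟩ := by
  have h : ∀ b : Fin (2 * j + 3), Bmat j ⟨2, by omega⟩ b * v b =
      (if b = ⟨0, by omega⟩ then v b else 0)
      + (if b = ⟨2, by omega⟩ then (1 - 8 * (j : ℤ)) * v b else 0) := by
    intro b
    simp only [Bmat, Matrix.of_apply, Fin.ext_iff]
    split_ifs <;> first | omega | (simp; done) | simp_all
  simp only [Matrix.mulVec, dotProduct, h, Finset.sum_add_distrib, Finset.sum_ite_eq',
    Finset.mem_univ, if_true]

lemma row_three (j : ℕ) (hj : 1 ≤ j) (v : Fin (2 * j + 3) → ℤ) :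
    (Bmat j).mulVec v ⟨3, by omega⟩ =
      v ⟨0, by omega⟩ + -3 * v ⟨3, by omega⟩ + v ⟨4, by omega⟩ := by
  have h : ∀ b : Fin (2 * j + 3), Bmat j ⟨3, by omega⟩ b * v b =
      (if b = ⟨0, by omega⟩ then v b else 0) + (if b = ⟨3, by omega⟩ then -3 * v b else 0)
      + (if b = ⟨4, by omega⟩ then v b else 0) := by
    intro b
    simp only [Bmat, Matrix.of_apply, Fin.ext_iff]
    split_ifs <;> first | omega | (simp; done) | simp_all
  simp only [Matrix.mulVec, dotProduct, h, Finset.sum_add_distrib, Finset.sum_ite_eq',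
    Finset.mem_univ, if_true]

lemma row_mid (j : ℕ) (i : ℕ) (hi : 3 ≤ i) (hi2 : i + 2 < 2 * j + 3)
    (v : Fin (2 * j + 3) → ℤ) :
    (Bmat j).mulVec v ⟨i + 1, by omega⟩ =
      v ⟨i, by omega⟩ + -2 * v ⟨i + 1, by omega⟩ + v ⟨i + 2, by omega⟩ := by
  have h : ∀ b : Fin (2 * j + 3), Bmat j ⟨i + 1, by omega⟩ b * v b =
      (if b = ⟨i, by omega⟩ then v b else 0) + (if b = ⟨i + 1, by omega⟩ then -2 * v b else 0)
      + (if b = ⟨i + 2, by omega⟩ then v b else 0) := by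
    intro b
    simp only [Bmat, Matrix.of_apply, Fin.ext_iff]
    split_ifs <;> first | omega | (simp; done) | simp_all
  simp only [Matrix.mulVec, dotProduct, h, Finset.sum_add_distrib, Finset.sum_ite_eq',
    Finset.mem_univ, if_true]

lemma row_last (j : ℕ) (hj : 1 ≤ j) (v : Fin (2 * j + 3) → ℤ) :
    (Bmat j).mulVec v ⟨2 * j + 2, by omega⟩ =
      v ⟨2 * j + 1, by omega⟩ + -5 * v ⟨2 * j + 2, by omega⟩ := by
  have h : ∀ b : Fin (2 * j + 3), Bmat j ⟨2 * j + 2, by omega⟩ b * v b =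
      (if b = ⟨2 * j + 1, by omega⟩ then v b else 0)
      + (if b = ⟨2 * j + 2, by omega⟩ then -5 * v b else 0) := by
    intro b
    simp only [Bmat, Matrix.of_apply, Fin.ext_iff]
    split_ifs <;> first | omega | (simp; done) | simp_all
  simp only [Matrix.mulVec, dotProduct, h, Finset.sum_add_distrib, Finset.sum_ite_eq',
    Finset.mem_univ, if_true]

lemma xvec_tail (j i : ℕ) (hi : 3 ≤ i) (h : i < 2 * j + 3) :
    xvec j ⟨i, h⟩ = 8 * (j : ℤ) + 9 - 4 * (i : ℤ) := by
  simp only [xvec]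
  split_ifs <;> first | omega | (push_cast; ring)

lemma xvec_zero (j : ℕ) : xvec j ⟨0, by omega⟩ = 16 * (j : ℤ) - 2 := by simp [xvec]
lemma xvec_one (j : ℕ) : xvec j ⟨1, by omega⟩ = 8 * (j : ℤ) - 1 := by simp [xvec]
lemma xvec_two (j : ℕ) : xvec j ⟨2, by omega⟩ = 2 := by simp [xvec]

lemma fin_cases_aux (j : ℕ) {P : Fin (2 * j + 3) → Prop}
    (h0 : P ⟨0, by omega⟩) (h1 : P ⟨1, by omega⟩) (h2 : P ⟨2, by omega⟩)
    (ht : ∀ i (h : i < 2 * j + 3), 3 ≤ i → P ⟨i, h⟩) (a : Fin (2 * j + 3)) : P a := by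
  obtain ⟨a, ha⟩ := a
  rcases a with _ | _ | _ | a
  · exact h0
  · exact h1
  · exact h2
  · exact ht _ ha (by omega)

lemma mulVec_xvec (j : ℕ) (hj : 1 ≤ j) : (Bmat j).mulVec (xvec j) = 0 := by
  funext a
  refine fin_cases_aux j (P := fun a => (Bmat j).mulVec (xvec j) a = 0) ?_ ?_ ?_ ?_ a
  · rw [row_zero j hj, xvec_zero, xvec_one, xvec_two, xvec_tail j 3 (by omega)]
    push_cast; ring
  · rw [row_one j hj, xvec_zero, xvec_one]
    ring
  · rw [row_two j hj, xvec_zero, xvec_two]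
    ring
  · intro i h hi
    rcases eq_or_lt_of_le hi with rfl | hi'
    · rw [row_three j hj, xvec_zero, xvec_tail j 3 (by omega), xvec_tail j 4 (by omega)]
      push_cast; ring
    · by_cases hl : i = 2 * j + 2
      · subst hl
        rw [row_last j hj, xvec_tail j _ (by omega), xvec_tail j _ (by omega)]
        push_cast; ring
      · obtain ⟨k, rfl⟩ : ∃ k, i = k + 1 := ⟨i - 1, by omega⟩
        rw [row_mid j k (by omega) (by omega), xvec_tail j _ (by omega),
          xvec_tail j _ (by omega), xvec_tail j _ (by omega)]
        push_cast; ring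

lemma kernel_tail (j : ℕ) (hj : 1 ≤ j) (v : Fin (2 * j + 3) → ℤ)
    (hv : (Bmat j).mulVec v = 0) (m : ℕ) :
    ∀ i (h : i < 2 * j + 3), 3 ≤ i → 2 * j + 2 = i + m →
      v ⟨i, h⟩ = v ⟨2 * j + 2, by omega⟩ * (8 * (j : ℤ) + 9 - 4 * (i : ℤ)) := by
  induction m using Nat.strong_induction_on with
  | _ m ih =>
    intro i h hi him
    rcases m with _ | _ | m
    · obtain rfl : i = 2 * j + 2 := by omega
      push_cast; ring
    · obtain rfl : i = 2 * j + 1 := by omega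
      have := row_last j hj v
      rw [hv, Pi.zero_apply] at this
      push_cast
      linear_combination -this
    · have r := row_mid j i hi (by omega) v
      rw [hv, Pi.zero_apply] at r
      have e1 := ih (m + 1) (by omega) (i + 1) (by omega) (by omega) (by omega)
      have e2 := ih m (by omega) (i + 2) (by omega) (by omega) (by omega)
      push_cast at e1 e2
      linear_combination -r + 2 * e1 - e2

/-- for `j ≥ 1`, the matrix `B_j` is negative semi-definite over `ℚ`, and its
integer kernel is exactly the subgroup generated by `x`. -/
theorem Bmat_negSemidef_and_kernel (j : ℕ) (hj : 1 ≤ j) :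
    (∀ v : Fin (2 * j + 3) → ℚ,
      ∑ a, ∑ b, v a * ((Bmat j a b : ℤ) : ℚ) * v b ≤ 0) ∧
    (∀ v : Fin (2 * j + 3) → ℤ, (Bmat j).mulVec v = 0 ↔ ∃ c : ℤ, v = c • xvec j) := by
  constructor
  · intro v
    refine negSemidef_aux (fun a b => ((Bmat j a b : ℤ) : ℚ)) (fun a => ((xvec j a : ℤ) : ℚ))
      ?_ ?_ ?_ ?_ v
    · intro a b
      have : Bmat j a b = Bmat j b a := by
        simp only [Bmat, Matrix.of_apply]
        split_ifs <;> first | rfl | omega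
      simp only [this]
    · intro a b hab
      have : 0 ≤ Bmat j a b := by
        have hab' : (a : ℕ) ≠ b := fun h => hab (Fin.ext h)
        simp only [Bmat, Matrix.of_apply]
        split_ifs <;> omega
      exact_mod_cast this
    · intro a
      have : 0 < xvec j a := by
        have := a.2
        simp only [xvec]
        split_ifs <;> push_cast <;> omega
      exact_mod_cast this
    · intro a
      have := congrFun (mulVec_xvec j hj) a
      simp only [Matrix.mulVec, dotProduct, Pi.zero_apply] at this
      exact_mod_cast this
  · intro v
    constructor
    · intro hv
      obtain ⟨c, hc⟩ : ∃ c, v ⟨2 * j + 2, by omega⟩ = c := ⟨_, rfl⟩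
      refine ⟨c, ?_⟩
      have ht : ∀ i (h : i < 2 * j + 3), 3 ≤ i →
          v ⟨i, h⟩ = v ⟨2 * j + 2, by omega⟩ * (8 * (j : ℤ) + 9 - 4 * (i : ℤ)) :=
        fun i h hi => kernel_tail j hj v hv (2 * j + 2 - i) i h hi (by omega)
      simp only [hc] at ht
      have r0 := row_zero j hj v
      have r1 := row_one j hj v
      have r3 := row_three j hj v
      rw [hv, Pi.zero_apply] at r0 r1 r3
      have t3 := ht 3 (by omega) (by omega)
      have t4 := ht 4 (by omega) (by omega)
      push_cast at t3 t4
      have v0 : v ⟨0, by omega⟩ = c * (16 * (j : ℤ) - 2) := by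
        linear_combination -r3 + 3 * t3 - t4
      have v1 : v ⟨1, by omega⟩ = c * (8 * (j : ℤ) - 1) := by
        have : 2 * v ⟨1, by omega⟩ = 2 * (c * (8 * (j : ℤ) - 1)) := by
          linear_combination r1 + v0
        omega
      have v2 : v ⟨2, by omega⟩ = c * 2 := by
        linear_combination -r0 + v0 - v1 - t3
      funext a
      refine fin_cases_aux j (P := fun a => v a = (c • xvec j) a) ?_ ?_ ?_ ?_ a
      · rw [Pi.smul_apply, smul_eq_mul, xvec_zero, v0]
      · rw [Pi.smul_apply, smul_eq_mul, xvec_one, v1]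
      · rw [Pi.smul_apply, smul_eq_mul, xvec_two, v2]
      · intro i h hi
        rw [Pi.smul_apply, smul_eq_mul, xvec_tail j i hi, ht i h hi]
    · rintro ⟨c, rfl⟩
      rw [Matrix.mulVec_smul, mulVec_xvec j hj, smul_zero]
end

section
/- Let j ≥ 1 be an integer and let B′_j, x′ be as specified. Then B′_j is negative semi-definite, i.e. vᵀ B′_j v ≤ 0 for every v ∈ ℚ^{8j+5}, and the integer kernel of B′_j is exactly the subgroup generated by x′: {v ∈ ℤ^{8j+5} : B′_j v = 0} = ℤ·x′. -/
set_option linter.unusedSimpArgs false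

/-- The intersection matrix `B′_j` of the plumbing `Γ′_j` of `−N_j`
(indices are `0`-indexed; the 1-indexed position is `(i : ℕ) + 1`). -/
def B'mat (j : ℕ) : Matrix (Fin (8 * j + 5)) (Fin (8 * j + 5)) ℤ :=
  Matrix.of fun a b =>
    let p := (a : ℕ) + 1
    let q := (b : ℕ) + 1
    if p = q then (if p = 8 * j + 1 then -2 * (j : ℤ) - 1 else -2)
    else if (p + 1 = q ∧ p ≤ 8 * j + 3) ∨ (q + 1 = p ∧ q ≤ 8 * j + 3) then 1
    else if (p = 8 * j - 1 ∧ q = 8 * j + 5) ∨ (q = 8 * j - 1 ∧ p = 8 * j + 5) then 1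
    else 0

/-- The generator `x′` of the integer kernel of `B′_j`. -/
def x'vec (j : ℕ) : Fin (8 * j + 5) → ℤ := fun a =>
  let p := (a : ℕ) + 1
  if p ≤ 8 * j - 1 then 2 * (p : ℤ)
  else if p = 8 * j then 8 * (j : ℤ) + 1
  else if p = 8 * j + 1 then 4
  else if p = 8 * j + 2 then 3
  else if p = 8 * j + 3 then 2
  else if p = 8 * j + 4 then 1
  else 8 * (j : ℤ) - 1


/-- Extension by zero of a vector to all natural indices. -/
def extVec {n : ℕ} (v : Fin n → ℤ) (k : ℕ) : ℤ := if h : k < n then v ⟨k, h⟩ else 0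

lemma sum_extVec {n : ℕ} (v : Fin n → ℤ) (k : ℕ) (d : ℤ) :
    ∑ b : Fin n, (if (b : ℕ) = k then d * v b else 0) = d * extVec v k := by
  unfold extVec
  split_ifs with h
  · rw [Finset.sum_eq_single ⟨k, h⟩]
    · simp
    · intro b _ hb
      rw [if_neg]
      intro h'
      exact hb (Fin.ext h')
    · simp
  · rw [mul_zero]
    apply Finset.sum_eq_zero
    intro b _
    rw [if_neg]
    have := b.2
    omega

lemma B'mat_row (j : ℕ) (hj : 1 ≤ j) (v : Fin (8 * j + 5) → ℤ) (a : Fin (8 * j + 5)) :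
    (B'mat j).mulVec v a =
      (if (a : ℕ) = 8 * j then -2 * (j : ℤ) - 1 else -2) * extVec v a
      + (if (a : ℕ) ≤ 8 * j + 2 then 1 else 0) * extVec v (a + 1)
      + (if 1 ≤ (a : ℕ) ∧ (a : ℕ) ≤ 8 * j + 3 then 1 else 0) * extVec v (a - 1)
      + (if (a : ℕ) = 8 * j - 2 then 1 else 0) * extVec v (8 * j + 4)
      + (if (a : ℕ) = 8 * j + 4 then 1 else 0) * extVec v (8 * j - 2) := by
  simp only [← sum_extVec, ← Finset.sum_add_distrib]
  unfold Matrix.mulVec dotProduct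
  apply Finset.sum_congr rfl
  intro b _
  have key : B'mat j a b =
      (if (b : ℕ) = a then (if (a : ℕ) = 8 * j then -2 * (j : ℤ) - 1 else -2) else 0)
      + (if (b : ℕ) = a + 1 then (if (a : ℕ) ≤ 8 * j + 2 then 1 else 0) else 0)
      + (if (b : ℕ) = a - 1 then
          (if 1 ≤ (a : ℕ) ∧ (a : ℕ) ≤ 8 * j + 3 then 1 else 0) else 0)
      + (if (b : ℕ) = 8 * j + 4 then (if (a : ℕ) = 8 * j - 2 then 1 else 0) else 0)
      + (if (b : ℕ) = 8 * j - 2 then (if (a : ℕ) = 8 * j + 4 then 1 else 0) else 0) := by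
    have ha := a.2
    have hb := b.2
    simp only [B'mat, Matrix.of_apply]
    generalize (a : ℕ) = p at *
    generalize (b : ℕ) = q at *
    have hc : q = p ∨ q = p + 1 ∨ p = q + 1 ∨ (q ≠ p ∧ q ≠ p + 1 ∧ p ≠ q + 1) := by omega
    rcases hc with h | h | h | ⟨h, h', h''⟩
    · subst h
      simp (disch := omega) only [if_pos, if_neg, if_true, if_false]
      split_ifs <;> omega
    · subst h
      by_cases hp : p ≤ 8 * j + 2
      · simp (disch := omega) only [if_pos, if_neg, if_true, if_false]
        norm_num
        omega
      · simp (disch := omega) only [if_pos, if_neg, if_true, if_false]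
        norm_num
    · subst h
      by_cases hp : q ≤ 8 * j + 2
      · simp (disch := omega) only [if_pos, if_neg, if_true, if_false]
        norm_num
        omega
      · simp (disch := omega) only [if_pos, if_neg, if_true, if_false]
        norm_num
    · simp (disch := omega) only [if_pos, if_neg, if_true, if_false]
      split_ifs <;> omega
  change B'mat j a b * v b = _
  rw [key]
  simp only [add_mul, ite_mul, zero_mul]

lemma B'mat_mulVec_x (j : ℕ) (hj : 1 ≤ j) : (B'mat j).mulVec (x'vec j) = 0 := by
  funext a
  rw [B'mat_row j hj]
  have ha := a.2
  have hx : ∀ k, extVec (x'vec j) k = if k + 1 ≤ 8 * j - 1 then 2 * ((k : ℤ) + 1)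
      else if k = 8 * j - 1 then 8 * (j : ℤ) + 1
      else if k = 8 * j then 4 else if k = 8 * j + 1 then 3 else if k = 8 * j + 2 then 2
      else if k = 8 * j + 3 then 1 else if k = 8 * j + 4 then 8 * (j : ℤ) - 1 else 0 := by
    intro k
    unfold extVec x'vec
    push_cast
    split_ifs <;> omega
  simp only [Pi.zero_apply]
  generalize (a : ℕ) = p at *
  have hc : p + 3 ≤ 8 * j ∨ p + 2 = 8 * j ∨ p + 1 = 8 * j ∨ p = 8 * j ∨ p = 8 * j + 1
    ∨ p = 8 * j + 2 ∨ p = 8 * j + 3 ∨ p = 8 * j + 4 := by omega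
  simp only [hx]
  rcases Nat.eq_zero_or_pos p with h0 | h0
  · subst h0
    simp (disch := omega) only [if_pos, if_neg, if_true, if_false]
    push_cast
    omega
  rcases hc with h | h | h | h | h | h | h | h <;>
  · simp (disch := omega) only [if_pos, if_neg, if_true, if_false]
    push_cast
    omega

lemma x'vec_pos (j : ℕ) (hj : 1 ≤ j) (a : Fin (8 * j + 5)) : 0 < x'vec j a := by
  unfold x'vec
  dsimp only
  split_ifs <;> omega

lemma B'mat_symm (j : ℕ) (a b : Fin (8 * j + 5)) : B'mat j a b = B'mat j b a := by
  simp only [B'mat, Matrix.of_apply]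
  split_ifs <;> omega

lemma B'mat_off (j : ℕ) (a b : Fin (8 * j + 5)) (h : a ≠ b) : 0 ≤ B'mat j a b := by
  have h' : (a : ℕ) ≠ b := fun e => h (Fin.ext e)
  simp only [B'mat, Matrix.of_apply]
  split_ifs <;> omega

/-- A symmetric matrix, nonnegative off the diagonal, which kills a positive vector, is
negative semidefinite. -/
lemma negSemidef_of_pos_kernel {n : ℕ} (B : Fin n → Fin n → ℚ) (x : Fin n → ℚ)
    (hs : ∀ a b, B a b = B b a) (ho : ∀ a b, a ≠ b → 0 ≤ B a b) (hx : ∀ a, 0 < x a)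
    (hk : ∀ a, ∑ b, B a b * x b = 0) (v : Fin n → ℚ) :
    ∑ a, ∑ b, v a * B a b * v b ≤ 0 := by
  obtain ⟨u, rfl⟩ : ∃ u : Fin n → ℚ, v = fun a => u a * x a :=
    ⟨fun a => v a / x a, by funext a; exact (div_mul_cancel₀ _ (hx a).ne').symm⟩
  have h1 : ∑ a, ∑ b, u a ^ 2 * x a * (B a b * x b) = 0 := by
    simp only [← Finset.mul_sum, hk, mul_zero, Finset.sum_const_zero]
  have h2 : ∑ a, ∑ b, u b ^ 2 * x b * (B a b * x a) = 0 := by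
    rw [Finset.sum_comm, ← h1]
    refine Finset.sum_congr rfl fun a _ => Finset.sum_congr rfl fun b _ => ?_
    rw [hs b a]
  have h3 : 0 ≤ ∑ a, ∑ b, B a b * x a * x b * (u a - u b) ^ 2 := by
    refine Finset.sum_nonneg fun a _ => Finset.sum_nonneg fun b _ => ?_
    by_cases h : a = b
    · subst h; simp
    · have := ho a b h
      have := hx a
      have := hx b
      positivity
  have h4 : ∑ a, ∑ b, B a b * x a * x b * (u a - u b) ^ 2 =
      ∑ a, ∑ b, u a ^ 2 * x a * (B a b * x b) + ∑ a, ∑ b, u b ^ 2 * x b * (B a b * x a)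
      - 2 * ∑ a, ∑ b, (u a * x a) * B a b * (u b * x b) := by
    simp only [Finset.mul_sum, ← Finset.sum_add_distrib, ← Finset.sum_sub_distrib]
    refine Finset.sum_congr rfl fun a _ => Finset.sum_congr rfl fun b _ => ?_
    ring
  rw [h1, h2] at h4
  simp only
  linarith

lemma B'mat_kernel (j : ℕ) (hj : 1 ≤ j) (v : Fin (8 * j + 5) → ℤ)
    (hv : (B'mat j).mulVec v = 0) : ∃ c : ℤ, v = c • x'vec j := by
  have row := fun (p : ℕ) (hp : p < 8 * j + 5) =>
    (B'mat_row j hj v ⟨p, hp⟩).symm.trans (congrFun hv ⟨p, hp⟩)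
  have hF : ∀ a : Fin (8 * j + 5), v a = extVec v a := by
    intro a; simp [extVec]
  simp only [Pi.zero_apply] at row
  generalize extVec v = F at *
  have hlin : ∀ k, (k + 2 ≤ 8 * j → F k = ((k : ℤ) + 1) * F 0) ∧
      (k + 3 ≤ 8 * j → F (k + 1) = ((k : ℤ) + 2) * F 0) := by
    intro k
    induction k with
    | zero =>
      refine ⟨fun _ => by simp, fun h => ?_⟩
      have := row 0 (by omega)
      simp (disch := omega) only [if_pos, if_neg, if_true, if_false] at this
      simp only [zero_add] at this
      push_cast
      linarith
    | succ k ih =>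
      refine ⟨fun h => ?_, fun h => ?_⟩
      · rw [ih.2 (by omega)]; push_cast; ring
      · have h1 := ih.1 (by omega)
        have h2 := ih.2 (by omega)
        have := row (k + 1) (by omega)
        simp (disch := omega) only [if_pos, if_neg, if_true, if_false] at this
        rw [Nat.add_sub_cancel, h1, h2] at this
        push_cast
        linarith
  obtain ⟨m, rfl⟩ : ∃ m, j = m + 1 := ⟨j - 1, by omega⟩
  have e0 := row (8 * (m + 1) + 4) (by omega)
  have e1 := row (8 * (m + 1) - 2) (by omega)
  have e2 := row (8 * (m + 1) - 1) (by omega)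
  have e3 := row (8 * (m + 1)) (by omega)
  have e4 := row (8 * (m + 1) + 1) (by omega)
  have e5 := row (8 * (m + 1) + 2) (by omega)
  simp (disch := omega) only [if_pos, if_neg, if_true, if_false] at e0 e1 e2 e3 e4 e5
  simp only [show 8 * m + 8 - 2 = 8 * m + 6 by omega,
    if_true, show 8 * m + 6 - 1 = 8 * m + 5 by omega,
    show 8 * m + 7 - 1 = 8 * m + 6 by omega, show 8 * (m + 1) = 8 * m + 8 by omega,
    show 8 * m + 8 - 1 = 8 * m + 7 by omega, Nat.add_assoc, Nat.reduceAdd,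
    show 8 * m + 9 - 1 = 8 * m + 8 by omega, show 8 * m + 10 - 1 = 8 * m + 9 by omega]
    at e0 e1 e2 e3 e4 e5
  have l6 := (hlin (8 * m + 6)).1 (by omega)
  have l5 := (hlin (8 * m + 5)).1 (by omega)
  push_cast at l5 l6 e3
  obtain ⟨c, hc⟩ : ∃ c, F 0 = 2 * c := by
    refine ⟨F (8 * m + 12) - (4 * (m : ℤ) + 3) * F 0, ?_⟩
    linarith
  rw [hc] at l5 l6
  have k12 : F (8 * m + 12) = (8 * (m : ℤ) + 7) * c := by linarith
  have k7 : F (8 * m + 7) = (8 * (m : ℤ) + 9) * c := by linarith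
  have k8 : F (8 * m + 8) = 4 * c := by linarith
  have k9 : F (8 * m + 9) = 3 * c := by rw [k8, k7] at e3; linarith
  have k10 : F (8 * m + 10) = 2 * c := by linarith
  have k11 : F (8 * m + 11) = c := by linarith
  refine ⟨c, ?_⟩
  funext a
  rw [hF a, Pi.smul_apply, smul_eq_mul]
  unfold x'vec
  have ha := a.2
  dsimp only
  generalize (a : ℕ) = p at *
  split_ifs with h1 h2 h3 h4 h5 h6
  · rw [(hlin p).1 (by omega), hc]; push_cast; ring
  · rw [show p = 8 * m + 7 by omega, k7]; push_cast; ring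
  · rw [show p = 8 * m + 8 by omega, k8]; ring
  · rw [show p = 8 * m + 9 by omega, k9]; ring
  · rw [show p = 8 * m + 10 by omega, k10]; ring
  · rw [show p = 8 * m + 11 by omega, k11]; ring
  · rw [show p = 8 * m + 12 by omega, k12]; push_cast; ring

/-- for `j ≥ 1`, the matrix `B′_j` is negative semi-definite over `ℚ`, and its
integer kernel is exactly the subgroup generated by `x′`. -/
theorem B'mat_negSemidef_and_kernel (j : ℕ) (hj : 1 ≤ j) :
    (∀ v : Fin (8 * j + 5) → ℚ,
      ∑ a, ∑ b, v a * ((B'mat j a b : ℤ) : ℚ) * v b ≤ 0) ∧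
    (∀ v : Fin (8 * j + 5) → ℤ, (B'mat j).mulVec v = 0 ↔ ∃ c : ℤ, v = c • x'vec j) := by
  refine ⟨fun v => ?_, fun v => ⟨B'mat_kernel j hj v, ?_⟩⟩
  · refine negSemidef_of_pos_kernel (fun a b => ((B'mat j a b : ℤ) : ℚ))
      (fun a => (x'vec j a : ℚ)) ?_ ?_ ?_ ?_ v
    · intro a b
      simp only [B'mat_symm j a b]
    · intro a b h
      exact_mod_cast B'mat_off j a b h
    · intro a
      exact_mod_cast x'vec_pos j hj a
    · intro a
      have := congrFun (B'mat_mulVec_x j hj) a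
      simp only [Matrix.mulVec, dotProduct, Pi.zero_apply] at this
      exact_mod_cast this
  · rintro ⟨c, rfl⟩
    rw [Matrix.mulVec_smul, B'mat_mulVec_x j hj, smul_zero]
end

section
/- Let j ≥ 1 be an integer and let B′_j, x′ be as specified. If t′ ∈ ℤ^{8j+5} is characteristic (t′ᵢ ≡ (B′_j)ᵢᵢ mod 2 for all i), satisfies t′ · x′ = 0, and is a leaf representative for B′_j, then t′ is equivalent (by a finite sequence of elementary moves for B′_j) to a vector t″ with t″ᵢ = 0 for 1 ≤ i ≤ 8j−1 and t″_{8j} ∈ {0, 2}. -/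
/-- `l` is the list of (doubled) `D`-type coordinates of `t` on the subgraph `1, …, 8j, 8j+5`. -/
def DMatch (j : ℕ) (t : Fin (8 * j + 5) → ℤ) (l : Fin (8 * j + 1) → ℤ) : Prop :=
  (∀ (i : ℕ) (h : i < 8 * j), t ⟨i, by omega⟩ = l ⟨i, by omega⟩ - l ⟨i + 1, by omega⟩) ∧
  t ⟨8 * j + 4, by omega⟩ = l ⟨8 * j - 1, by omega⟩ + l ⟨8 * j, by omega⟩

/-- Coordinates realised by vectors equivalent to `t`. -/
def DReach (j : ℕ) (t : Fin (8 * j + 5) → ℤ) (l : Fin (8 * j + 1) → ℤ) : Prop :=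
  (∃ t', MoveEquiv (B'mat j) t t' ∧ DMatch j t' l) ∧ ∀ a b, (2 : ℤ) ∣ l a - l b

theorem B'mat_apply (j a b : ℕ) (ha : a < 8 * j + 5) (hb : b < 8 * j + 5) :
    B'mat j ⟨a, ha⟩ ⟨b, hb⟩ =
      if a = b then (if a = 8 * j then -2 * (j : ℤ) - 1 else -2)
      else if (a + 1 = b ∧ a ≤ 8 * j + 2) ∨ (b + 1 = a ∧ b ≤ 8 * j + 2) then 1
      else if (a + 2 = 8 * j ∧ b = 8 * j + 4) ∨ (b + 2 = 8 * j ∧ a = 8 * j + 4) then 1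
      else 0 := by
  simp only [B'mat, Matrix.of_apply]
  split_ifs <;> first | rfl | omega

/-- A move in either direction at a vertex of weight `-2`. -/
theorem move_step (j : ℕ) (t t' : Fin (8 * j + 5) → ℤ) (hleaf : IsLeafRep (B'mat j) t)
    (ht : MoveEquiv (B'mat j) t t') (i : Fin (8 * j + 5)) (hi : B'mat j i i = -2)
    (heven : (2 : ℤ) ∣ t' i) :
    MoveEquiv (B'mat j) t (fun v => t' v + t' i * B'mat j v i) := by
  have hs := hleaf t' ht i
  rw [hi] at hs
  obtain ⟨c, hc⟩ := heven
  have : t' i = 0 ∨ t' i = 2 ∨ t' i = -2 := by omega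
  rcases this with h | h | h
  · simpa [h] using ht
  · refine Relation.ReflTransGen.tail ht ⟨i, Or.inl ⟨by rw [h, hi]; rfl, ?_⟩⟩
    rw [h]
  · refine Relation.ReflTransGen.tail ht ⟨i, Or.inr ⟨by rw [h, hi], ?_⟩⟩
    rw [h]; funext v; ring

theorem DReach.swap_adj {j : ℕ} (hj : 1 ≤ j) {t : Fin (8 * j + 5) → ℤ}
    (hleaf : IsLeafRep (B'mat j) t) {l : Fin (8 * j + 1) → ℤ} (hl : DReach j t l)
    (i : Fin (8 * j)) : DReach j t (l ∘ Equiv.swap i.castSucc i.succ) := by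
  obtain ⟨⟨t', ht, hm1, hm2⟩, hpar⟩ := hl
  obtain ⟨i, hi⟩ := i
  refine ⟨⟨_, move_step j t t' hleaf ht ⟨i, by omega⟩ ?_ ?_, ?_, ?_⟩, fun a b => hpar _ _⟩
  · rw [B'mat_apply]; split_ifs <;> omega
  · rw [hm1 i hi]; exact hpar _ _
  · intro k hk
    beta_reduce
    rw [B'mat_apply, hm1 i hi, hm1 k hk]
    simp only [Function.comp, Equiv.swap_apply_def, Fin.castSucc_mk, Fin.succ_mk, Fin.mk.injEq]
    rcases (by omega : k = i ∨ k = i + 1 ∨ k + 1 = i ∨ (k ≠ i ∧ k ≠ i + 1 ∧ k + 1 ≠ i))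
      with h | h | h | ⟨h1, h2, h3⟩
    · subst h; simp; rw [if_neg (by omega)]; ring
    · subst h
      have e : ¬ i + 1 + 1 = i := by omega
      simp [e]; rw [if_pos (by omega)]; ring
    · subst h
      have e : ¬ k = k + 1 + 1 := by omega
      simp [e]; rw [if_pos (by omega)]; ring
    · rw [if_neg h1, if_neg (by omega), if_neg (by omega)]
      simp [h1, h2, h3]
  · beta_reduce
    rw [B'mat_apply, hm1 i hi, hm2]
    simp only [Function.comp, Equiv.swap_apply_def, Fin.castSucc_mk, Fin.succ_mk, Fin.mk.injEq]
    rw [if_neg (by omega), if_neg (by omega)]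
    rcases (by omega : i + 1 = 8 * j ∨ i + 2 = 8 * j ∨ (i + 2 < 8 * j))
      with h | h | h
    · have e1 : 8 * j - 1 = i := by omega
      simp only [← h]; simp; ring
    · have e1 : 8 * j - 1 = i + 1 := by omega
      simp only [← h]; simp; ring
    · rw [if_neg (by omega), if_neg (by omega), if_neg (by omega), if_neg (by omega),
        if_neg (by omega)]
      ring

theorem DReach.perm {j : ℕ} (hj : 1 ≤ j) {t : Fin (8 * j + 5) → ℤ}
    (hleaf : IsLeafRep (B'mat j) t) (σ : Equiv.Perm (Fin (8 * j + 1)))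
    {l : Fin (8 * j + 1) → ℤ} (hl : DReach j t l) : DReach j t (l ∘ σ) := by
  have hσ : σ ∈ Submonoid.closure
      (Set.range fun i : Fin (8 * j) => Equiv.swap i.castSucc i.succ) := by
    rw [Equiv.Perm.mclosure_swap_castSucc_succ]; trivial
  induction hσ using Submonoid.closure_induction generalizing l with
  | mem x hx => obtain ⟨i, rfl⟩ := hx; exact hl.swap_adj hj hleaf i
  | one => exact hl
  | mul x y _ _ hx hy => exact hy (hx hl)

theorem DReach.flip_last {j : ℕ} (hj : 1 ≤ j) {t : Fin (8 * j + 5) → ℤ}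
    (hleaf : IsLeafRep (B'mat j) t) {l : Fin (8 * j + 1) → ℤ} (hl : DReach j t l) :
    DReach j t (fun k => if (k : ℕ) = 8 * j - 1 then - l ⟨8 * j, by omega⟩
      else if (k : ℕ) = 8 * j then - l ⟨8 * j - 1, by omega⟩ else l k) := by
  obtain ⟨⟨t', ht, hm1, hm2⟩, hpar⟩ := hl
  refine ⟨⟨_, move_step j t t' hleaf ht ⟨8 * j + 4, by omega⟩ ?_ ?_, ?_, ?_⟩, ?_⟩
  · rw [B'mat_apply]; split_ifs <;> omega
  · rw [hm2]
    have := hpar ⟨8 * j - 1, by omega⟩ ⟨8 * j, by omega⟩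
    omega
  · intro k hk
    beta_reduce
    rw [B'mat_apply, hm2, hm1 k hk, if_neg (by omega), if_neg (by omega)]
    dsimp only
    rcases (by omega : k + 1 = 8 * j ∨ k + 2 = 8 * j ∨ (k + 2 < 8 * j))
      with h | h | h
    · have e1 : 8 * j - 1 = k := by omega
      simp only [← h]; simp; ring
    · have e1 : 8 * j - 1 = k + 1 := by omega
      simp only [← h]; simp; ring
    · rw [if_neg (by omega), if_neg (by omega), if_neg (by omega), if_neg (by omega),
        if_neg (by omega)]
      ring
  · beta_reduce
    rw [B'mat_apply, hm2]
    dsimp only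
    rw [if_pos rfl, if_neg (by omega), if_pos rfl, if_neg (by omega), if_pos rfl]
    ring
  · intro a b
    have h1 := hpar ⟨8 * j - 1, by omega⟩ ⟨8 * j, by omega⟩
    have h2 := hpar a ⟨8 * j, by omega⟩
    have h3 := hpar b ⟨8 * j, by omega⟩
    dsimp only
    split_ifs <;> omega

theorem exists_perm_last {j : ℕ} (hj : 1 ≤ j) (a b : Fin (8 * j + 1)) (hab : a ≠ b) :
    ∃ σ : Equiv.Perm (Fin (8 * j + 1)), σ ⟨8 * j - 1, by omega⟩ = a ∧
      σ ⟨8 * j, by omega⟩ = b := by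
  set p : Fin (8 * j + 1) := ⟨8 * j - 1, by omega⟩ with hp
  set q : Fin (8 * j + 1) := ⟨8 * j, by omega⟩ with hq
  have hpq : p ≠ q := by rw [hp, hq]; intro h; have := Fin.mk.inj h; omega
  refine ⟨Equiv.swap (Equiv.swap p a q) b * Equiv.swap p a, ?_, ?_⟩
  · rw [Equiv.Perm.mul_apply, Equiv.swap_apply_left, Equiv.swap_apply_of_ne_of_ne _ hab]
    intro h
    have : Equiv.swap p a p = Equiv.swap p a q := by rw [Equiv.swap_apply_left]; exact h
    exact hpq ((Equiv.swap p a).injective this)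
  · rw [Equiv.Perm.mul_apply, Equiv.swap_apply_left]

theorem DReach.bounds {j : ℕ} (hj : 1 ≤ j) {t : Fin (8 * j + 5) → ℤ}
    (hleaf : IsLeafRep (B'mat j) t) {l : Fin (8 * j + 1) → ℤ} (hl : DReach j t l)
    (a b : Fin (8 * j + 1)) (hab : a ≠ b) :
    -2 ≤ l a - l b ∧ l a - l b ≤ 2 ∧ -2 ≤ l a + l b ∧ l a + l b ≤ 2 := by
  obtain ⟨σ, h1, h2⟩ := exists_perm_last hj a b hab
  obtain ⟨⟨t', ht, hm1, hm2⟩, -⟩ := hl.perm hj hleaf σ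
  have e := hm1 (8 * j - 1) (by omega)
  have e1 : 8 * j - 1 + 1 = 8 * j := by omega
  simp only [e1, Function.comp, h1, h2] at e hm2
  have s1 := hleaf t' ht ⟨8 * j - 1, by omega⟩
  have s2 := hleaf t' ht ⟨8 * j + 4, by omega⟩
  rw [B'mat_apply, if_pos rfl, if_neg (by omega)] at s1 s2
  omega

/-- Negate the last entry and some other entry (which is moved to position `8j-1`). -/
theorem DReach.neg_pair {j : ℕ} (hj : 1 ≤ j) {t : Fin (8 * j + 5) → ℤ}
    (hleaf : IsLeafRep (B'mat j) t) {l : Fin (8 * j + 1) → ℤ} (hl : DReach j t l)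
    (a b : Fin (8 * j + 1)) (hab : a ≠ b) :
    DReach j t (fun k => if k = a ∨ k = b then - l k else l k) := by
  obtain ⟨σ, h1, h2⟩ := exists_perm_last hj a b hab
  have h := ((hl.perm hj hleaf σ).flip_last hj hleaf).perm hj hleaf (σ⁻¹)
  have h' := h.perm hj hleaf (Equiv.swap a b)
  convert h' using 1
  have i1 : σ⁻¹ a = ⟨8 * j - 1, by omega⟩ := by rw [← h1]; simp
  have i2 : σ⁻¹ b = ⟨8 * j, by omega⟩ := by rw [← h2]; simp
  funext k
  simp only [Function.comp, h1, h2]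
  by_cases ka : k = a
  · subst ka
    simp only [Equiv.swap_apply_left, i2]
    have e : ¬ 8 * j = 8 * j - 1 := by omega
    simp [e]
  · by_cases kb : k = b
    · subst kb
      simp only [Equiv.swap_apply_right, i1]
      simp
    · rw [Equiv.swap_apply_of_ne_of_ne ka kb, if_neg (by tauto), if_neg, if_neg]
      · simp
      · intro h; apply kb
        have : σ⁻¹ k = σ⁻¹ b := by rw [i2]; exact Fin.ext h
        exact σ⁻¹.injective this
      · intro h; apply ka
        have : σ⁻¹ k = σ⁻¹ a := by rw [i1]; exact Fin.ext h
        exact σ⁻¹.injective this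

theorem exists_DReach {j : ℕ} (hj : 1 ≤ j) (t : Fin (8 * j + 5) → ℤ)
    (hchar : ∀ i, (2 : ℤ) ∣ (t i - B'mat j i i)) : ∃ l, DReach j t l := by
  have hev : ∀ (i : ℕ) (h : i < 8 * j + 5), i ≠ 8 * j → (2 : ℤ) ∣ t ⟨i, h⟩ := by
    intro i h hi
    have := hchar ⟨i, h⟩
    rw [B'mat_apply, if_pos rfl, if_neg hi] at this
    omega
  set T : ℕ → ℤ := fun i => if h : i < 8 * j then t ⟨i, by omega⟩ else 0 with hT
  have hTe : ∀ i, (2 : ℤ) ∣ T i := by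
    intro i; simp only [hT]; split_ifs with h
    · exact hev _ _ (by omega)
    · simp
  set c := (t ⟨8 * j + 4, by omega⟩ - t ⟨8 * j - 1, by omega⟩) / 2 with hc
  have d1 := hev (8 * j + 4) (by omega) (by omega)
  have d2 := hev (8 * j - 1) (by omega) (by omega)
  have hstep : ∀ i, i < 8 * j → ∑ m ∈ Finset.Ico i (8 * j), T m
      = T i + ∑ m ∈ Finset.Ico (i + 1) (8 * j), T m := fun i hi =>
    Finset.sum_eq_sum_Ico_succ_bot hi T
  refine ⟨fun k => c + ∑ i ∈ Finset.Ico (k : ℕ) (8 * j), T i,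
    ⟨t, Relation.ReflTransGen.refl, ?_, ?_⟩, ?_⟩
  · intro i hi
    simp only [hstep i hi]
    have : T i = t ⟨i, by omega⟩ := by simp only [hT]; rw [dif_pos hi]
    rw [this]; ring
  · simp only [hstep (8 * j - 1) (by omega)]
    have e1 : 8 * j - 1 + 1 = 8 * j := by omega
    have : T (8 * j - 1) = t ⟨8 * j - 1, by omega⟩ := by
      simp only [hT]; rw [dif_pos (by omega)]
    simp only [e1, this, Finset.Ico_self, Finset.sum_empty]
    omega
  · intro a b
    have h1 : (2 : ℤ) ∣ ∑ i ∈ Finset.Ico (a : ℕ) (8 * j), T i :=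
      Finset.dvd_sum fun i _ => hTe i
    have h2 : (2 : ℤ) ∣ ∑ i ∈ Finset.Ico (b : ℕ) (8 * j), T i :=
      Finset.dvd_sum fun i _ => hTe i
    dsimp only
    omega

theorem DReach.finish {j : ℕ} (hj : 1 ≤ j) {t : Fin (8 * j + 5) → ℤ}
    {l : Fin (8 * j + 1) → ℤ} (hl : DReach j t l) (c : ℤ)
    (h1 : ∀ k : Fin (8 * j + 1), (k : ℕ) ≠ 8 * j → l k = c)
    (h2 : l ⟨8 * j, by omega⟩ = c ∨ l ⟨8 * j, by omega⟩ = c - 2) :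
    ∃ t'' : Fin (8 * j + 5) → ℤ, MoveEquiv (B'mat j) t t'' ∧
      (∀ i : Fin (8 * j + 5), (i : ℕ) + 1 ≤ 8 * j - 1 → t'' i = 0) ∧
      (∀ i : Fin (8 * j + 5), (i : ℕ) + 1 = 8 * j → t'' i = 0 ∨ t'' i = 2) := by
  obtain ⟨⟨t', ht, hm1, hm2⟩, -⟩ := hl
  refine ⟨t', ht, ?_, ?_⟩
  · rintro ⟨i, hi⟩ h
    dsimp only at h
    rw [hm1 i (by omega), h1 _ (by dsimp only; omega), h1 _ (by dsimp only; omega)]; ring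
  · rintro ⟨i, hi⟩ h
    dsimp only at h
    have e := hm1 i (by omega)
    rw [h1 _ (by dsimp only; omega)] at e
    simp only [h] at e
    omega


/-- for `j ≥ 1`, a characteristic leaf representative `t′` for `B′_j`
orthogonal to the kernel generator `x′` is equivalent to a vector `t″` vanishing at the
1-indexed positions `1, …, 8j−1` and with `t″_{8j} ∈ {0, 2}`. -/
theorem leaf_rep_chain_normal_form (j : ℕ) (hj : 1 ≤ j) (t : Fin (8 * j + 5) → ℤ)
    (hchar : ∀ i, (2 : ℤ) ∣ (t i - B'mat j i i))
    (horth : ∑ i, t i * x'vec j i = 0)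
    (hleaf : IsLeafRep (B'mat j) t) :
    ∃ t'' : Fin (8 * j + 5) → ℤ, MoveEquiv (B'mat j) t t'' ∧
      (∀ i : Fin (8 * j + 5), (i : ℕ) + 1 ≤ 8 * j - 1 → t'' i = 0) ∧
      (∀ i : Fin (8 * j + 5), (i : ℕ) + 1 = 8 * j → t'' i = 0 ∨ t'' i = 2) := by
  classical
  obtain ⟨l0, hl0⟩ := exists_DReach hj t hchar
  -- choose coordinates with the fewest negative entries
  obtain ⟨l, hl, hmin⟩ : ∃ l, DReach j t l ∧ ∀ l', DReach j t l' →
      (Finset.univ.filter fun k => l k < 0).card ≤ (Finset.univ.filter fun k => l' k < 0).card := by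
    let f : (Fin (8 * j + 1) → ℤ) → ℕ := fun l => (Finset.univ.filter fun k => l k < 0).card
    obtain ⟨l, hl, h⟩ := (InvImage.wf f Nat.lt_wfRel.wf).has_min {l | DReach j t l} ⟨l0, hl0⟩
    exact ⟨l, hl, fun l' hl' => not_lt.mp (h l' hl')⟩
  have hb := hl.bounds hj hleaf
  have hpar := hl.2
  -- two distinct indices with negative entries are impossible
  have hneg : ∀ a b, a ≠ b → l a < 0 → l b < 0 → False := by
    intro a b hab ha hb'
    have := hmin _ (hl.neg_pair hj hleaf a b hab)
    refine absurd this (not_le.mpr (Finset.card_lt_card ?_))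
    rw [Finset.ssubset_iff_of_subset]
    · refine ⟨a, by simpa using ha, ?_⟩
      simp; omega
    · intro k hk
      simp only [Finset.mem_filter, Finset.mem_univ, true_and] at hk ⊢
      by_cases h : k = a ∨ k = b
      · rcases h with rfl | rfl <;> assumption
      · rw [if_neg h] at hk; exact hk
  set q : Fin (8 * j + 1) := ⟨8 * j, by omega⟩ with hq
  have hother : ∀ a : Fin (8 * j + 1), ∃ b, b ≠ a := by
    intro a
    by_cases h : a = q
    · refine ⟨⟨0, by omega⟩, ?_⟩
      rw [h, hq]; intro h; have := Fin.mk.inj h; omega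
    · exact ⟨q, fun e => h e.symm⟩
  have hsmall : ∀ a, -2 ≤ l a ∧ l a ≤ 2 := by
    intro a
    obtain ⟨b, hba⟩ := hother a
    have := hb b a hba
    omega
  have hne : ∀ k : Fin (8 * j + 1), (k : ℕ) ≠ 8 * j → k ≠ q := by
    intro k hk h; apply hk; rw [h]
  by_cases hodd : (2 : ℤ) ∣ l q
  · -- even case: at most one nonzero entry
    have hev : ∀ a, (2 : ℤ) ∣ l a := fun a => by have := hpar a q; omega
    by_cases hz : ∃ a, l a ≠ 0
    · obtain ⟨a, ha⟩ := hz
      have hz' : ∀ b, b ≠ a → l b = 0 := by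
        intro b hba
        have h1 := hb b a hba
        have h2 := hev a
        have h3 := hev b
        omega
      -- move the entry to the end
      have hl2 := hl.perm hj hleaf (Equiv.swap q a)
      have v1 : (l ∘ Equiv.swap q a) q = l a := by simp
      have v2 : ∀ k, k ≠ q → (l ∘ Equiv.swap q a) k = 0 := by
        intro k hk
        apply hz'
        intro h
        apply hk
        apply (Equiv.swap q a).injective
        rw [Equiv.swap_apply_left]; exact h
      have hcase : l a = 2 ∨ l a = -2 := by
        have := hev a; have := hsmall a; omega
      rcases hcase with h | h
      · obtain ⟨b, hbq⟩ := hother q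
        refine (hl2.neg_pair hj hleaf b q hbq).finish hj 0 ?_ (Or.inr ?_)
        · intro k hk
          have := v2 k (hne k hk)
          rw [this]; simp
        · change (if q = b ∨ q = q then -(l ∘ Equiv.swap q a) q else _) = _
          rw [if_pos (Or.inr rfl), v1, h]; rfl
      · refine hl2.finish hj 0 (fun k hk => v2 k (hne k hk)) (Or.inr ?_)
        rw [← hq, v1, h]; rfl
    · push Not at hz
      exact hl.finish hj 0 (fun k _ => hz k) (Or.inl (hz _))
  · -- odd case: all entries are `±1`
    have hone : ∀ a, l a = 1 ∨ l a = -1 := by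
      intro a
      have := hpar a q
      have := hsmall a
      omega
    by_cases hz : ∃ a, l a = -1
    · obtain ⟨a, ha⟩ := hz
      have hl2 := hl.perm hj hleaf (Equiv.swap q a)
      refine hl2.finish hj 1 ?_ (Or.inr ?_)
      · intro k hk
        rcases hone (Equiv.swap q a k) with h | h
        · exact h
        · exfalso
          refine hneg (Equiv.swap q a k) a ?_ (by omega) (by omega)
          intro e
          apply hne k hk
          apply (Equiv.swap q a).injective
          rw [Equiv.swap_apply_left]; exact e
      · rw [← hq]; simp [ha]
    · push Not at hz
      have hz' : ∀ k, l k = 1 := fun k => (hone k).resolve_right (hz k)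
      exact hl.finish hj 1 (fun k _ => hz' k) (Or.inl (hz' _))
end

section
/- Let j ≥ 1 be an integer and let B′_j, x′ be as specified. If t′ ∈ ℤ^{8j+5} is characteristic (t′ᵢ ≡ (B′_j)ᵢᵢ mod 2 for all i), satisfies t′ · x′ = 0, and is a leaf representative for B′_j, then t′ is equivalent (by a finite sequence of elementary moves for B′_j) to t₁ or to t₂, where t₁ ∈ ℤ^{8j+5} is the vector whose entries are all 0 except (t₁)_{8j+1} = −1 and (t₁)_{8j+3} = 2, and t₂ ∈ ℤ^{8j+5} is the vector whose entries are all 0 except (t₂)_{8j} = 2, (t₂)_{8j+1} = −1, and (t₂)_{8j+5} = −2. -/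
/-- The leaf vector `t₁`: all entries zero except `(t₁)_{8j+1} = −1`, `(t₁)_{8j+3} = 2`. -/
def t1vec (j : ℕ) : Fin (8 * j + 5) → ℤ := fun a =>
  let p := (a : ℕ) + 1
  if p = 8 * j + 1 then -1
  else if p = 8 * j + 3 then 2
  else 0

/-- The leaf vector `t₂`: all entries zero except `(t₂)_{8j} = 2`, `(t₂)_{8j+1} = −1`,
`(t₂)_{8j+5} = −2`. -/
def t2vec (j : ℕ) : Fin (8 * j + 5) → ℤ := fun a =>
  let p := (a : ℕ) + 1
  if p = 8 * j then 2
  else if p = 8 * j + 1 then -1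
  else if p = 8 * j + 5 then -2
  else 0


set_option linter.unusedSimpArgs false
set_option linter.unnecessarySeqFocus false

/-- `t` is given by weight coordinates `Y` (for the `D_{8j+1}` part) and `Z` (for `A_3`). -/
structure WRep (j : ℕ) (t : Fin (8 * j + 5) → ℤ) (Y : Fin (8 * j + 1) → ℤ) (Z : Fin 4 → ℤ) :
    Prop where
  chain : ∀ (p : ℕ) (h : p < 8 * j), t ⟨p, by omega⟩ = Y ⟨p, by omega⟩ - Y ⟨p + 1, by omega⟩
  leg : ∀ (h : 1 ≤ j), t ⟨8 * j + 4, by omega⟩ = Y ⟨8 * j - 1, by omega⟩ + Y ⟨8 * j, by omega⟩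
  z0 : t ⟨8 * j + 1, by omega⟩ = Z 0 - Z 1
  z1 : t ⟨8 * j + 2, by omega⟩ = Z 1 - Z 2
  z2 : t ⟨8 * j + 3, by omega⟩ = Z 2 - Z 3
  ctr : 4 * t ⟨8 * j, by omega⟩ + 2 * (∑ i, Y i - 2 * Y ⟨8 * j, by omega⟩)
    + 4 * Z 0 - (Z 0 + Z 1 + Z 2 + Z 3) = 0

def Reach (j : ℕ) (t : Fin (8 * j + 5) → ℤ) (Y : Fin (8 * j + 1) → ℤ) (Z : Fin 4 → ℤ) : Prop :=
  ∃ t', MoveEquiv (B'mat j) t t' ∧ (∀ i, (2 : ℤ) ∣ (t' i - B'mat j i i)) ∧ WRep j t' Y Z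

theorem WRep.unique {j : ℕ} (hj : 1 ≤ j) {t t' Y Z} (h : WRep j t Y Z) (h' : WRep j t' Y Z) :
    t = t' := by
  funext ⟨p, hp⟩
  have hc : p < 8 * j ∨ p = 8 * j ∨ p = 8 * j + 1 ∨ p = 8 * j + 2 ∨ p = 8 * j + 3 ∨
    p = 8 * j + 4 := by omega
  rcases hc with hc | rfl | rfl | rfl | rfl | rfl
  · rw [h.chain p hc, h'.chain p hc]
  · have := h.ctr; have := h'.ctr; omega
  · rw [h.z0, h'.z0]
  · rw [h.z1, h'.z1]
  · rw [h.z2, h'.z2]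
  · rw [h.leg hj, h'.leg hj]

theorem B_diag {j : ℕ} (i : Fin (8 * j + 5)) (hi : (i : ℕ) ≠ 8 * j) : B'mat j i i = -2 := by
  simp [B'mat]; omega

/-- one reflection at a `-2` vertex -/
theorem refl_move {j : ℕ} {t : Fin (8 * j + 5) → ℤ} (hleaf : IsLeafRep (B'mat j) t)
    (hc : ∀ i, (2 : ℤ) ∣ (t i - B'mat j i i)) (i : Fin (8 * j + 5)) (hi : (i : ℕ) ≠ 8 * j) :
    MoveEquiv (B'mat j) t (fun v => t v + t i * B'mat j v i) ∧
    ∀ v, (2 : ℤ) ∣ (t v + t i * B'mat j v i - B'mat j v v) := by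
  have h1 := hleaf t Relation.ReflTransGen.refl i
  have h2 := hc i
  rw [B_diag i hi] at h1 h2
  have h3 : t i = 2 ∨ t i = -2 ∨ t i = 0 := by omega
  have hd := B_diag i hi
  constructor
  · rcases h3 with h | h | h
    · refine Relation.ReflTransGen.single ⟨i, Or.inl ⟨by rw [h, hd]; rfl, ?_⟩⟩
      funext v; rw [h]
    · refine Relation.ReflTransGen.single ⟨i, Or.inr ⟨by rw [h, hd], ?_⟩⟩
      funext v; rw [h]; ring
    · have : (fun v => t v + t i * B'mat j v i) = t := by funext v; rw [h]; ring
      rw [this]; exact Relation.ReflTransGen.refl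
  · intro v
    have h4 : (2 : ℤ) ∣ t i := by omega
    have h5 := (hc v).add (h4.mul_right (B'mat j v i))
    have e : t v + t i * B'mat j v i - B'mat j v v =
      t v - B'mat j v v + t i * B'mat j v i := by ring
    rw [e]; exact h5

theorem reach_of {j : ℕ} {t : Fin (8 * j + 5) → ℤ} (hleaf : IsLeafRep (B'mat j) t)
    {Y Z} (h : Reach j t Y Z) (i : Fin (8 * j + 5)) (hi : (i : ℕ) ≠ 8 * j) {Y' Z'}
    (hr : ∀ s, WRep j s Y Z → WRep j (fun v => s v + s i * B'mat j v i) Y' Z') :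
    Reach j t Y' Z' := by
  obtain ⟨s, hs, hc, hrep⟩ := h
  have hl : IsLeafRep (B'mat j) s := fun k hk => hleaf k (hs.trans hk)
  obtain ⟨h1, h2⟩ := refl_move hl hc i hi
  exact ⟨_, hs.trans h1, h2, hr s hrep⟩

theorem reach_swapY {j : ℕ} (hj : 1 ≤ j) {t : Fin (8 * j + 5) → ℤ}
    (hleaf : IsLeafRep (B'mat j) t)
    {Y Z} (h : Reach j t Y Z) (i : Fin (8 * j)) :
    Reach j t (Y ∘ Equiv.swap i.castSucc i.succ) Z := by
  obtain ⟨i, hi⟩ := i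
  refine reach_of hleaf h ⟨i, by omega⟩ (by simp; omega) ?_
  intro s hs
  have hch := hs.chain i hi
  constructor
  · intro p hp
    simp only [Function.comp, Equiv.swap_apply_def, hch, hs.chain p hp, B'mat, Matrix.of_apply,
      Fin.ext_iff, Fin.val_succ, Fin.val_castSucc, Fin.succ_mk, Fin.castSucc_mk]
    grind
  · intro _
    simp only [Function.comp, Equiv.swap_apply_def, hch, hs.leg hj, B'mat, Matrix.of_apply,
      Fin.ext_iff, Fin.val_succ, Fin.val_castSucc, Fin.succ_mk, Fin.castSucc_mk]
    grind
  · simp only [hs.z0, B'mat, Matrix.of_apply]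
    grind
  · simp only [hs.z1, B'mat, Matrix.of_apply]
    grind
  · simp only [hs.z2, B'mat, Matrix.of_apply]
    grind
  · have := hs.ctr
    have e : ∑ k, (Y ∘ Equiv.swap (Fin.castSucc ⟨i, hi⟩) (Fin.succ ⟨i, hi⟩)) k = ∑ k, Y k :=
      Equiv.sum_comp _ Y
    rw [e]
    simp only [Function.comp, Equiv.swap_apply_def, hch, B'mat, Matrix.of_apply,
      Fin.ext_iff, Fin.val_succ, Fin.val_castSucc, Fin.succ_mk, Fin.castSucc_mk]
    grind

theorem reach_leg {j : ℕ} (hj : 1 ≤ j) {t : Fin (8 * j + 5) → ℤ}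
    (hleaf : IsLeafRep (B'mat j) t)
    {Y Z} (h : Reach j t Y Z) (a b : Fin (8 * j + 1)) (ha : (a : ℕ) = 8 * j - 1)
    (hb : (b : ℕ) = 8 * j) :
    Reach j t (fun k => Y k - (if k = a then Y a + Y b else 0) -
      (if k = b then Y a + Y b else 0)) Z := by
  obtain ⟨a, ha'⟩ := a
  obtain ⟨b, hb'⟩ := b
  simp only at ha hb
  subst ha hb
  refine reach_of hleaf h ⟨8 * j + 4, by omega⟩ (by simp) ?_
  intro s hs
  have hch := hs.leg hj
  constructor
  · intro p hp
    simp only [hch, hs.chain p hp, B'mat, Matrix.of_apply, Fin.ext_iff]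
    grind
  · intro _
    simp only [hch, B'mat, Matrix.of_apply, Fin.ext_iff]
    grind
  · simp only [hs.z0, B'mat, Matrix.of_apply]
    grind
  · simp only [hs.z1, B'mat, Matrix.of_apply]
    grind
  · simp only [hs.z2, B'mat, Matrix.of_apply]
    grind
  · have := hs.ctr
    rw [Finset.sum_sub_distrib, Finset.sum_sub_distrib, Finset.sum_ite_eq', Finset.sum_ite_eq']
    simp only [hch, B'mat, Matrix.of_apply, Fin.ext_iff, Finset.mem_univ, if_true]
    grind

theorem reach_swapZ {j : ℕ} (hj : 1 ≤ j) {t : Fin (8 * j + 5) → ℤ}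
    (hleaf : IsLeafRep (B'mat j) t)
    {Y Z} (h : Reach j t Y Z) (i : Fin 3) :
    Reach j t Y (Z ∘ Equiv.swap i.castSucc i.succ) := by
  refine reach_of hleaf h ⟨8 * j + 1 + i, by omega⟩ (by simp only; omega) ?_
  intro s hs
  have h0 := hs.z0
  have h1 := hs.z1
  have h2 := hs.z2
  have hch : s ⟨8 * j + 1 + i, by omega⟩ = Z i.castSucc - Z i.succ := by
    fin_cases i <;> assumption
  constructor
  · intro p hp
    simp only [hs.chain p hp, B'mat, Matrix.of_apply]
    grind
  · intro _
    simp only [hs.leg hj, B'mat, Matrix.of_apply]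
    grind
  · simp only [hch, hs.z0, B'mat, Matrix.of_apply]
    fin_cases i <;> simp [Equiv.swap_apply_def] <;> grind
  · simp only [hch, hs.z1, B'mat, Matrix.of_apply]
    fin_cases i <;> simp [Equiv.swap_apply_def] <;> grind
  · simp only [hch, hs.z2, B'mat, Matrix.of_apply]
    fin_cases i <;> simp [Equiv.swap_apply_def] <;> grind
  · have := hs.ctr
    simp only [hch, B'mat, Matrix.of_apply]
    fin_cases i <;> simp [Equiv.swap_apply_def] <;> grind

theorem reach_permY {j : ℕ} (hj : 1 ≤ j) {t : Fin (8 * j + 5) → ℤ}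
    (hleaf : IsLeafRep (B'mat j) t) {Z} (π : Equiv.Perm (Fin (8 * j + 1))) :
    ∀ {Y}, Reach j t Y Z → Reach j t (Y ∘ π) Z := by
  have hm : π ∈ Submonoid.closure
      (Set.range fun i : Fin (8 * j) ↦ Equiv.swap i.castSucc i.succ) := by
    rw [Equiv.Perm.mclosure_swap_castSucc_succ]; trivial
  induction hm using Submonoid.closure_induction with
  | mem x hx => obtain ⟨i, rfl⟩ := hx; intro Y h; exact reach_swapY hj hleaf h i
  | one => intro Y h; exact h
  | mul x y _ _ hx hy => intro Y h; exact hy (hx h)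

theorem reach_permZ {j : ℕ} (hj : 1 ≤ j) {t : Fin (8 * j + 5) → ℤ}
    (hleaf : IsLeafRep (B'mat j) t) {Y} (π : Equiv.Perm (Fin 4)) :
    ∀ {Z}, Reach j t Y Z → Reach j t Y (Z ∘ π) := by
  have hm : π ∈ Submonoid.closure
      (Set.range fun i : Fin 3 ↦ Equiv.swap i.castSucc i.succ) := by
    rw [Equiv.Perm.mclosure_swap_castSucc_succ]; trivial
  induction hm using Submonoid.closure_induction with
  | mem x hx => obtain ⟨i, rfl⟩ := hx; intro Y h; exact reach_swapZ hj hleaf h i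
  | one => intro Y h; exact h
  | mul x y _ _ hx hy => intro Y h; exact hy (hx h)

theorem exists_perm_pair {α : Type*} [DecidableEq α] {a b c d : α} (hab : a ≠ b) (hcd : c ≠ d) :
    ∃ π : Equiv.Perm α, π a = c ∧ π b = d := by
  refine ⟨(Equiv.swap a c).trans (Equiv.swap (Equiv.swap a c b) d), ?_, ?_⟩
  · simp only [Equiv.trans_apply, Equiv.swap_apply_left]
    apply Equiv.swap_apply_of_ne_of_ne
    · intro h
      have : Equiv.swap a c a = Equiv.swap a c b := by rw [Equiv.swap_apply_left]; exact h
      exact hab ((Equiv.swap a c).injective this)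
    · exact hcd
  · simp

theorem reach_neg {j : ℕ} (hj : 1 ≤ j) {t : Fin (8 * j + 5) → ℤ}
    (hleaf : IsLeafRep (B'mat j) t) {Y Z} (h : Reach j t Y Z) {c d} (hcd : c ≠ d) :
    Reach j t (fun k => if k = c ∨ k = d then - Y k else Y k) Z := by
  set a : Fin (8 * j + 1) := ⟨8 * j - 1, by omega⟩ with ha
  set b : Fin (8 * j + 1) := ⟨8 * j, by omega⟩ with hb
  have hab : a ≠ b := by simp [ha, hb]; omega
  obtain ⟨π, hc, hd⟩ := exists_perm_pair hab hcd
  have h1 := reach_permY hj hleaf π h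
  have h2 := reach_leg hj hleaf h1 a b rfl rfl
  have h3 := reach_permY hj hleaf (Equiv.swap a b) h2
  have h4 := reach_permY hj hleaf π⁻¹ h3
  convert h4 using 1
  funext k
  obtain ⟨l, rfl⟩ := π.surjective k
  subst hc hd
  have hinv : π⁻¹ (π l) = l := π.symm_apply_apply l
  simp only [Function.comp, hinv, π.injective.eq_iff]
  by_cases h5 : l = a
  · subst h5
    simp [hab, hab.symm]
  · by_cases h6 : l = b
    · subst h6
      simp [hab, hab.symm]
    · rw [Equiv.swap_apply_of_ne_of_ne h5 h6]
      simp [h5, h6]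

theorem reach_bound {j : ℕ} {t : Fin (8 * j + 5) → ℤ}
    (hleaf : IsLeafRep (B'mat j) t) {t'} (ht : MoveEquiv (B'mat j) t t')
    (hc : ∀ i, (2 : ℤ) ∣ (t' i - B'mat j i i)) (i : Fin (8 * j + 5)) (hi : (i : ℕ) ≠ 8 * j) :
    -2 ≤ t' i ∧ t' i ≤ 2 ∧ (2 : ℤ) ∣ t' i := by
  have h1 := hleaf t' ht i
  have h2 := hc i
  rw [B_diag i hi] at h1 h2
  omega

theorem boundY {j : ℕ} (hj : 1 ≤ j) {t : Fin (8 * j + 5) → ℤ}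
    (hleaf : IsLeafRep (B'mat j) t) {Y Z} (h : Reach j t Y Z) {c d} (hcd : c ≠ d) :
    (-2 ≤ Y c - Y d ∧ Y c - Y d ≤ 2 ∧ (2 : ℤ) ∣ Y c - Y d) ∧
    (-2 ≤ Y c + Y d ∧ Y c + Y d ≤ 2) := by
  set a : Fin (8 * j + 1) := ⟨8 * j - 1, by omega⟩ with ha
  set b : Fin (8 * j + 1) := ⟨8 * j, by omega⟩ with hb
  have hab : a ≠ b := by simp [ha, hb]; omega
  obtain ⟨π, hc, hd⟩ := exists_perm_pair hab hcd
  obtain ⟨t', h1, h2, h3⟩ := reach_permY hj hleaf π h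
  have e1 := h3.chain (8 * j - 1) (by omega)
  have e2 := h3.leg hj
  have e3 : (⟨8 * j - 1 + 1, by omega⟩ : Fin (8 * j + 1)) = b := by
    rw [hb, Fin.mk.injEq]; omega
  rw [e3] at e1
  simp only [Function.comp, ← ha, ← hb, hc, hd] at e1 e2
  have b1 := reach_bound hleaf h1 h2 ⟨8 * j - 1, by omega⟩ (by simp only; omega)
  have b2 := reach_bound hleaf h1 h2 ⟨8 * j + 4, by omega⟩ (by simp only; omega)
  rw [e1] at b1
  rw [e2] at b2
  exact ⟨b1, b2.1, b2.2.1⟩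

theorem boundZ {j : ℕ} (hj : 1 ≤ j) {t : Fin (8 * j + 5) → ℤ}
    (hleaf : IsLeafRep (B'mat j) t) {Y Z} (h : Reach j t Y Z) {c d} (hcd : c ≠ d) :
    (-2 ≤ Z c - Z d ∧ Z c - Z d ≤ 2 ∧ (2 : ℤ) ∣ Z c - Z d) := by
  obtain ⟨π, hc, hd⟩ := exists_perm_pair (show (0 : Fin 4) ≠ 1 by decide) hcd
  obtain ⟨t', h1, h2, h3⟩ := reach_permZ hj hleaf π h
  have e1 := h3.z0
  simp only [Function.comp, hc, hd] at e1
  have b1 := reach_bound hleaf h1 h2 ⟨8 * j + 1, by omega⟩ (by simp only; omega)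
  rw [e1] at b1
  exact b1

theorem sum_bound {n : ℕ} (u : Fin n → ℤ) (hu : ∀ k, u k = 1 ∨ u k = -1)
    (hp : ∀ a b, a ≠ b → u a + u b ≤ 0) : ∑ k, u k ≤ 2 - n := by
  by_cases h : ∃ a, u a = 1
  · obtain ⟨a, ha⟩ := h
    have : ∀ k ∈ Finset.univ, u k ≤ (if k = a then 2 else 0) - 1 := by
      intro k _
      split_ifs with hk
      · subst hk; omega
      · have := hp k a hk
        have := hu k
        omega
    refine (Finset.sum_le_sum this).trans ?_
    rw [Finset.sum_sub_distrib, Finset.sum_ite_eq']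
    simp
  · push Not at h
    have : ∀ k ∈ Finset.univ, u k ≤ (-1 : ℤ) := by
      intro k _
      have := hu k
      have := h k
      omega
    refine (Finset.sum_le_sum this).trans ?_
    simp

theorem center_le {j : ℕ} {t : Fin (8 * j + 5) → ℤ} (h : SatStar (B'mat j) t) :
    t ⟨8 * j, by omega⟩ ≤ 2 * j + 1 := by
  have := (h ⟨8 * j, by omega⟩).2
  simp [B'mat] at this
  omega

theorem sort_mono {j : ℕ} (hj : 1 ≤ j) {t : Fin (8 * j + 5) → ℤ}
    (hleaf : IsLeafRep (B'mat j) t) {Y Z} (h : Reach j t Y Z) :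
    ∃ Z', Reach j t Y Z' ∧ Z' 0 ≤ Z' 1 ∧ Z' 1 ≤ Z' 2 ∧ Z' 2 ≤ Z' 3 := by
  have hm := Tuple.monotone_sort Z
  exact ⟨_, reach_permZ hj hleaf (Tuple.sort Z) h, hm (by decide), hm (by decide),
    hm (by decide)⟩

theorem sort_anti {j : ℕ} (hj : 1 ≤ j) {t : Fin (8 * j + 5) → ℤ}
    (hleaf : IsLeafRep (B'mat j) t) {Y Z} (h : Reach j t Y Z) :
    ∃ Z', Reach j t Y Z' ∧ Z' 1 ≤ Z' 0 ∧ Z' 2 ≤ Z' 1 ∧ Z' 3 ≤ Z' 2 := by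
  obtain ⟨Z', h', a, b, c⟩ := sort_mono hj hleaf h
  refine ⟨_, reach_permZ hj hleaf Fin.revPerm h', ?_, ?_, ?_⟩
  · exact c
  · exact b
  · exact a

theorem no_odd {j : ℕ} (hj : 1 ≤ j) {t : Fin (8 * j + 5) → ℤ}
    (hleaf : IsLeafRep (B'mat j) t) {Y Z} (h : Reach j t Y Z)
    (hodd : ∀ k, Y k = 1 ∨ Y k = -1) : False := by
  obtain ⟨Z, h, s1, s2, s3⟩ := sort_mono hj hleaf h
  set l : Fin (8 * j + 1) := ⟨8 * j, by omega⟩ with hl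
  have hbd : ∀ Y, Reach j t Y Z → -(∑ k, Y k - 2 * Y l) ≤ 4 * j + 2 := by
    rintro Y ⟨t', h1, h2, h3⟩
    have e := h3.ctr
    rw [← hl] at e
    have := center_le (hleaf t' h1)
    omega
  obtain ⟨z, ⟨Y, hY, ho, hz⟩, hmax⟩ := Int.exists_greatest_of_bdd
    (P := fun z => ∃ Y, Reach j t Y Z ∧ (∀ k, Y k = 1 ∨ Y k = -1) ∧
      z = -(∑ k, Y k - 2 * Y l))
    ⟨4 * j + 2, by rintro z ⟨Y, hY, _, rfl⟩; exact hbd Y hY⟩ ⟨_, Y, h, hodd, rfl⟩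
  have hsum : ∀ Y : Fin (8 * j + 1) → ℤ,
      ∑ k, (if k = l then - Y k else Y k) = ∑ k, Y k - 2 * Y l := by
    intro Y
    have : ∀ k, (if k = l then - Y k else Y k) = Y k - (if k = l then 2 * Y l else 0) := by
      intro k; split_ifs with hk
      · subst hk; ring
      · ring
    simp only [this]
    rw [Finset.sum_sub_distrib, Finset.sum_ite_eq']
    simp
  have hb := sum_bound (fun k => if k = l then - Y k else Y k)
    (by intro k; have := ho k; split_ifs <;> omega) (by
      intro a b hab
      have hm := hmax _ ⟨_, reach_neg hj hleaf hY hab,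
        (by intro k; have := ho k; split_ifs <;> omega), rfl⟩
      rw [← hsum, hz, ← hsum] at hm
      have : ∀ k, (if k = l then -(if k = a ∨ k = b then - Y k else Y k)
          else (if k = a ∨ k = b then - Y k else Y k)) =
          (if k = l then - Y k else Y k)
          - (if k = a then 2 * (if a = l then - Y a else Y a) else 0)
          - (if k = b then 2 * (if b = l then - Y b else Y b) else 0) := by
        intro k
        grind
      simp only [this] at hm
      rw [Finset.sum_sub_distrib, Finset.sum_sub_distrib, Finset.sum_ite_eq',
        Finset.sum_ite_eq'] at hm
      simp only [Finset.mem_univ, if_true] at hm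
      linarith)
  rw [hsum] at hb
  have := hbd Y hY
  push_cast at hb
  omega

theorem wrep_t1 {j : ℕ} {Y Z} (hY : ∀ k, Y k = 0) (h01 : Z 0 = Z 1) (h12 : Z 1 = Z 2 + 2)
    (h23 : Z 2 = Z 3) : WRep j (t1vec j) Y Z := by
  have hs : ∑ i, Y i = 0 := Finset.sum_eq_zero (fun k _ => hY k)
  constructor
  · intro p hp; simp only [hY, t1vec]; grind
  · intro p; simp only [hY, t1vec]; grind
  · simp [t1vec]; omega
  · simp [t1vec]; omega
  · simp [t1vec]; omega
  · rw [hs, hY]; simp [t1vec]; omega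

theorem wrep_t2 {j : ℕ} {Z} (h01 : Z 0 = Z 1) (h12 : Z 1 = Z 2)
    (h23 : Z 2 = Z 3) :
    WRep j (t2vec j) (fun k => if k = ⟨8 * j, by omega⟩ then -2 else 0) Z := by
  constructor
  · intro p hp; simp only [t2vec, Fin.ext_iff]; grind
  · intro p; simp only [t2vec, Fin.ext_iff]; grind
  · simp [t2vec]; omega
  · simp [t2vec]; omega
  · simp [t2vec]; omega
  · rw [Finset.sum_ite_eq']; simp [t2vec]; omega

theorem center_odd {j : ℕ} {t : Fin (8 * j + 5) → ℤ} (h : ∀ i, (2 : ℤ) ∣ (t i - B'mat j i i)) :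
    t ⟨8 * j, by omega⟩ % 2 = 1 := by
  have := h ⟨8 * j, by omega⟩
  simp [B'mat] at this
  omega

theorem zero_case {j : ℕ} (hj : 1 ≤ j) {t : Fin (8 * j + 5) → ℤ}
    (hleaf : IsLeafRep (B'mat j) t) {Y Z} (h : Reach j t Y Z) (hY : ∀ k, Y k = 0) :
    MoveEquiv (B'mat j) t (t1vec j) := by
  obtain ⟨Z, h, s1, s2, s3⟩ := sort_anti hj hleaf h
  have b1 := boundZ hj hleaf h (show (0 : Fin 4) ≠ 3 by decide)
  have b2 := boundZ hj hleaf h (show (1 : Fin 4) ≠ 3 by decide)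
  have b3 := boundZ hj hleaf h (show (2 : Fin 4) ≠ 3 by decide)
  obtain ⟨t', h1, h2, h3⟩ := h
  have hs : ∑ i, Y i = 0 := Finset.sum_eq_zero (fun k _ => hY k)
  have e := h3.ctr
  rw [hs, hY] at e
  have ho := center_odd h2
  have c1 : Z 0 = Z 3 ∨ Z 0 = Z 3 + 2 := by omega
  have c2 : Z 1 = Z 3 ∨ Z 1 = Z 3 + 2 := by omega
  have c3 : Z 2 = Z 3 ∨ Z 2 = Z 3 + 2 := by omega
  have : Z 0 = Z 1 ∧ Z 1 = Z 2 + 2 ∧ Z 2 = Z 3 := by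
    rcases c1 with c1 | c1 <;> rcases c2 with c2 | c2 <;> rcases c3 with c3 | c3 <;> omega
  rw [← h3.unique hj (wrep_t1 hY this.1 this.2.1 this.2.2)]
  exact h1

theorem vec_case {j : ℕ} (hj : 1 ≤ j) {t : Fin (8 * j + 5) → ℤ}
    (hleaf : IsLeafRep (B'mat j) t) {Y Z} (h : Reach j t Y Z) {a}
    (ha : Y a = 2 ∨ Y a = -2) (hY : ∀ k, k ≠ a → Y k = 0) :
    MoveEquiv (B'mat j) t (t2vec j) := by
  have h' : Reach j t (fun k => if k = ⟨8 * j, by omega⟩ then -2 else 0) Z := by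
    set l : Fin (8 * j + 1) := ⟨8 * j, by omega⟩ with hl
    have h1 := reach_permY hj hleaf (Equiv.swap a l) h
    have e : (Y ∘ Equiv.swap a l) = fun k => if k = l then Y a else 0 := by
      funext k
      simp only [Function.comp]
      split_ifs with hk
      · subst hk; simp
      · apply hY
        intro h5
        apply hk
        have := congrArg (Equiv.swap a l) h5
        simpa using this
    rw [e] at h1
    rcases ha with ha | ha
    · have hne : (⟨0, by omega⟩ : Fin (8 * j + 1)) ≠ l := by
        rw [hl, Ne, Fin.mk.injEq]; omega
      have h2 := reach_neg hj hleaf h1 hne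
      convert h2 using 1
      funext k
      grind
    · rw [ha] at h1; exact h1
  obtain ⟨Z, h, s1, s2, s3⟩ := sort_anti hj hleaf h'
  have b1 := boundZ hj hleaf h (show (0 : Fin 4) ≠ 3 by decide)
  have b2 := boundZ hj hleaf h (show (1 : Fin 4) ≠ 3 by decide)
  have b3 := boundZ hj hleaf h (show (2 : Fin 4) ≠ 3 by decide)
  obtain ⟨t', h1, h2, h3⟩ := h
  have e := h3.ctr
  rw [Finset.sum_ite_eq'] at e
  simp only [Finset.mem_univ, if_true] at e
  have ho := center_odd h2
  have c1 : Z 0 = Z 3 ∨ Z 0 = Z 3 + 2 := by omega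
  have c2 : Z 1 = Z 3 ∨ Z 1 = Z 3 + 2 := by omega
  have c3 : Z 2 = Z 3 ∨ Z 2 = Z 3 + 2 := by omega
  have : Z 0 = Z 1 ∧ Z 1 = Z 2 ∧ Z 2 = Z 3 := by
    rcases c1 with c1 | c1 <;> rcases c2 with c2 | c2 <;> rcases c3 with c3 | c3 <;> omega
  rw [← h3.unique hj (wrep_t2 this.1 this.2.1 this.2.2)]
  exact h1

theorem abel_sum (y : ℕ → ℤ) (m : ℕ) :
    ∑ p ∈ Finset.range m, (y p - y (p + 1)) * (2 * ((p : ℤ) + 1)) =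
      2 * (∑ p ∈ Finset.range m, y p - m * y m) := by
  induction m with
  | zero => simp
  | succ m ih => rw [Finset.sum_range_succ, Finset.sum_range_succ, ih]; push_cast; ring

theorem init_reach {j : ℕ} (hj : 1 ≤ j) {t : Fin (8 * j + 5) → ℤ}
    (hchar : ∀ i, (2 : ℤ) ∣ (t i - B'mat j i i))
    (horth : ∑ i, t i * x'vec j i = 0) : ∃ Y Z, Reach j t Y Z := by
  obtain ⟨m, hm⟩ : ∃ m, 8 * j = m + 1 := ⟨8 * j - 1, by omega⟩
  let τ : ℕ → ℤ := fun p => if h : p < 8 * j + 5 then t ⟨p, h⟩ else 0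
  have hτ : ∀ p (h : p < 8 * j + 5), t ⟨p, h⟩ = τ p := by
    intro p h; simp [τ, h]
  let X : ℕ → ℤ := fun p =>
    if p + 1 ≤ 8 * j - 1 then 2 * ((p : ℤ) + 1)
    else if p + 1 = 8 * j then 8 * (j : ℤ) + 1
    else if p + 1 = 8 * j + 1 then 4
    else if p + 1 = 8 * j + 2 then 3
    else if p + 1 = 8 * j + 3 then 2
    else if p + 1 = 8 * j + 4 then 1
    else 8 * (j : ℤ) - 1
  have hsum : ∑ p ∈ Finset.range (8 * j + 5), τ p * X p = 0 := by
    rw [← Fin.sum_univ_eq_sum_range (fun p => τ p * X p), ← horth]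
    refine Finset.sum_congr rfl ?_
    rintro ⟨p, hp⟩ _
    rw [hτ p hp]
    simp [x'vec, X]
  have ev : ∀ p, p < 8 * j + 5 → p ≠ 8 * j → (2 : ℤ) ∣ τ p := by
    intro p hp hne
    have := hchar ⟨p, hp⟩
    rw [B_diag _ hne, hτ] at this
    omega
  let c : ℤ := (τ (8 * j + 4) - τ (8 * j - 1)) / 2
  let y : ℕ → ℤ := fun p => c + ∑ q ∈ Finset.Ico p (8 * j), τ q
  have hy : ∀ p, p < 8 * j → τ p = y p - y (p + 1) := by
    intro p hp
    simp only [y]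
    rw [Finset.sum_eq_sum_Ico_succ_bot hp]; ring
  have hyl : y (8 * j) = c := by simp [y]
  have hleg : τ (8 * j + 4) = y (8 * j - 1) + y (8 * j) := by
    have e1 := hy (8 * j - 1) (by omega)
    rw [show 8 * j - 1 + 1 = 8 * j by omega] at e1
    have := ev (8 * j + 4) (by omega) (by omega)
    have := ev (8 * j - 1) (by omega) (by omega)
    simp only [c] at hyl
    omega
  let Z : Fin 4 → ℤ := ![τ (8 * j + 1) + τ (8 * j + 2) + τ (8 * j + 3),
    τ (8 * j + 2) + τ (8 * j + 3), τ (8 * j + 3), 0]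
  refine ⟨fun k => y k, Z, t, Relation.ReflTransGen.refl, hchar, ?_⟩
  constructor
  · intro p hp; rw [hτ]; exact hy p hp
  · intro _; rw [hτ]; exact hleg
  · rw [hτ]; simp [Z, add_assoc]
  · rw [hτ]; simp [Z]
  · rw [hτ]; simp [Z]
  · rw [hτ, Fin.sum_univ_eq_sum_range (fun p => y p)]
    rw [show 8 * j + 5 = m + 1 + 1 + 1 + 1 + 1 + 1 by omega] at hsum
    iterate 6 rw [Finset.sum_range_succ] at hsum
    have hs1 : ∑ p ∈ Finset.range m, τ p * X p =
        ∑ p ∈ Finset.range m, (y p - y (p + 1)) * (2 * ((p : ℤ) + 1)) := by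
      refine Finset.sum_congr rfl ?_
      intro p hp
      rw [Finset.mem_range] at hp
      rw [hy p (by omega)]
      simp only [X]
      rw [if_pos (by omega)]
    rw [hs1, abel_sum] at hsum
    have x0 : X m = 8 * (j : ℤ) + 1 := by simp only [X]; grind
    have x1 : X (m + 1) = 4 := by simp only [X]; grind
    have x2 : X (m + 1 + 1) = 3 := by simp only [X]; grind
    have x3 : X (m + 1 + 1 + 1) = 2 := by simp only [X]; grind
    have x4 : X (m + 1 + 1 + 1 + 1) = 1 := by simp only [X]; grind
    have x5 : X (m + 1 + 1 + 1 + 1 + 1) = 8 * (j : ℤ) - 1 := by simp only [X]; grind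
    have y0 := hy m (by omega)
    rw [x0, x1, x2, x3, x4, x5, y0] at hsum
    rw [hm] at hleg
    simp only [Nat.add_sub_cancel, add_assoc, Nat.reduceAdd] at hleg hsum
    rw [hleg] at hsum
    have hmz : (m : ℤ) = 8 * j - 1 := by omega
    rw [hmz] at hsum
    simp only [Z, hm, Matrix.cons_val, add_assoc, Nat.reduceAdd]
    rw [show m + 1 + 1 = m + 2 by rfl] at *
    rw [Finset.sum_range_succ, Finset.sum_range_succ]
    linear_combination hsum

/-- for `j ≥ 1`, every characteristic leaf representative for `B′_j` orthogonal
to the kernel generator `x′` is equivalent (by elementary moves for `B′_j`) to `t₁` or to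
`t₂`. -/
theorem leaf_rep_equiv_t1_or_t2 (j : ℕ) (hj : 1 ≤ j) (t : Fin (8 * j + 5) → ℤ)
    (hchar : ∀ i, (2 : ℤ) ∣ (t i - B'mat j i i))
    (horth : ∑ i, t i * x'vec j i = 0)
    (hleaf : IsLeafRep (B'mat j) t) :
    MoveEquiv (B'mat j) t (t1vec j) ∨ MoveEquiv (B'mat j) t (t2vec j) := by
  obtain ⟨Y, Z, h⟩ := init_reach hj hchar horth
  have hB := fun c d (hcd : c ≠ d) => boundY hj hleaf h hcd
  have hex : ∀ k : Fin (8 * j + 1), ∃ k', k ≠ k' := by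
    intro k
    by_cases hk : (k : ℕ) = 0
    · exact ⟨⟨1, by omega⟩, by rw [Ne, Fin.ext_iff]; simp [hk]⟩
    · exact ⟨⟨0, by omega⟩, by rw [Ne, Fin.ext_iff]; simp [hk]⟩
  by_cases h0 : ∀ k, Y k = 0
  · exact Or.inl (zero_case hj hleaf h h0)
  push Not at h0
  obtain ⟨a, ha⟩ := h0
  by_cases hp : (2 : ℤ) ∣ Y a
  · right
    refine vec_case hj hleaf h (a := a) ?_ ?_
    · obtain ⟨b, hb⟩ := hex a
      have := hB a b hb
      omega
    · intro k hk
      have := hB k a hk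
      omega
  · exfalso
    refine no_odd hj hleaf h ?_
    intro k
    by_cases hk : k = a
    · subst hk
      obtain ⟨b, hb⟩ := hex k
      have := hB k b hb
      omega
    · have := hB k a hk
      omega
end

section
/- Let j ≥ 1 and 0 ≤ r ≤ 2j−2 be integers. Define a sequence of rational numbers by c₀ = (−8j+3+4r)/(8j−7−4r) and c_{i+1} = −2 − 1/cᵢ for 0 ≤ i < r. Then cᵢ ≠ 0 for all 0 ≤ i ≤ r, and −3 − 1/c_r = (−16j+2)/(8j−3). In other words, the continued fraction −3 − 1/(−2 − 1/(⋯ −2 − 1/((−8j+3+4r)/(8j−7−4r)))) with r copies of −2 equals (−16j+2)/(8j−3). -/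
/-- The continued-fraction sequence: `c₀ = (−8j+3+4r)/(8j−7−4r)`, `c_{i+1} = −2 − 1/cᵢ`. -/
noncomputable def cfrac (j r : ℕ) : ℕ → ℚ
  | 0 => ((-8) * (j : ℚ) + 3 + 4 * (r : ℚ)) / (8 * (j : ℚ) - 7 - 4 * (r : ℚ))
  | (i + 1) => -2 - 1 / cfrac j r i

theorem cfrac_closed (j r : ℕ) (hr : r + 2 ≤ 2 * j) (i : ℕ) :
    cfrac j r i = -(8 * (j : ℚ) - 3 - 4 * r + 4 * i) / (8 * (j : ℚ) - 7 - 4 * r + 4 * i) := by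
  have h : (r : ℚ) + 2 ≤ 2 * j := by exact_mod_cast hr
  induction i with
  | zero =>
    simp only [cfrac]
    push_cast
    congr 1 <;> ring
  | succ i ih =>
    have hi : (0 : ℚ) ≤ i := Nat.cast_nonneg i
    have h1 : 8 * (j : ℚ) - 3 - 4 * r + 4 * i ≠ 0 := by
      intro h0
      linarith
    have h2 : 8 * (j : ℚ) - 7 - 4 * r + 4 * i ≠ 0 := by
      intro h0
      linarith
    have h3 : 8 * (j : ℚ) - 7 - 4 * r + 4 * ((i + 1 : ℕ) : ℚ)
        = 8 * (j : ℚ) - 3 - 4 * r + 4 * i := by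
      push_cast
      ring
    rw [cfrac, ih, h3, one_div_div, div_neg, sub_neg_eq_add, eq_div_iff h1, add_mul,
      div_mul_cancel₀ _ h1]
    push_cast
    ring

/-- for integers `j ≥ 1` and `0 ≤ r ≤ 2j−2`, every term `cᵢ` with `i ≤ r` of the
continued-fraction sequence is nonzero, and
`−3 − 1/c_r = (−16j+2)/(8j−3)`; i.e. the continued fraction
`−3 − 1/(−2 − 1/(⋯ −2 − 1/((−8j+3+4r)/(8j−7−4r))))` with `r` copies of `−2` equals
`(−16j+2)/(8j−3)`. -/
theorem continued_fraction_identity (j r : ℕ) (hj : 1 ≤ j) (hr : r + 2 ≤ 2 * j) :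
    (∀ i : ℕ, i ≤ r → cfrac j r i ≠ 0) ∧
    -3 - 1 / cfrac j r r = ((-16) * (j : ℚ) + 2) / (8 * (j : ℚ) - 3) := by
  have h : (r : ℚ) + 2 ≤ 2 * j := by exact_mod_cast hr
  have hj' : (1 : ℚ) ≤ j := by exact_mod_cast hj
  constructor
  · intro i _
    have hi : (0 : ℚ) ≤ i := Nat.cast_nonneg i
    rw [cfrac_closed j r hr i]
    refine div_ne_zero ?_ ?_
    · intro h0
      linarith
    · intro h0
      linarith
  · have h1 : 8 * (j : ℚ) - 3 ≠ 0 := by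
      intro h0
      linarith
    rw [cfrac_closed j r hr r, sub_add_cancel, sub_add_cancel, one_div_div, div_neg,
      sub_neg_eq_add, eq_div_iff h1, add_mul, div_mul_cancel₀ _ h1]
    ring
end

section
/- Let j ≥ 1 be an integer and let B_j be as specified. Let k₁ = (−1, 0, 5−4j, 3, 0, …, 0, −3) ∈ ℤ^{2j+3} and k₂ = (−1, 0, 3−4j, 3, 0, …, 0, 1) ∈ ℤ^{2j+3} (entries in positions 5 through 2j+2 equal to zero). Then −k₁ is equivalent to k₂ by a finite sequence of elementary moves for B_j. -/
theorem col0 (j v : ℕ) (hv : v < 2 * j + 3) (h0 : 0 < 2 * j + 3) :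
    Bmat j ⟨v, hv⟩ ⟨0, h0⟩ = if v = 0 then -1 else if v ≤ 3 then 1 else 0 := by
  simp only [Bmat, Matrix.of_apply]
  grind

theorem col1 (j v : ℕ) (hv : v < 2 * j + 3) (h0 : 1 < 2 * j + 3) :
    Bmat j ⟨v, hv⟩ ⟨1, h0⟩ = if v = 1 then -2 else if v = 0 then 1 else 0 := by
  simp only [Bmat, Matrix.of_apply]
  grind

theorem col3 (j v : ℕ) (hv : v < 2 * j + 3) (h0 : 3 < 2 * j + 3) :
    Bmat j ⟨v, hv⟩ ⟨3, h0⟩ =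
      if v = 3 then -3 else if v = 0 then 1 else if v = 4 then 1 else 0 := by
  simp only [Bmat, Matrix.of_apply]
  grind

theorem colq (j v q : ℕ) (hv : v < 2 * j + 3) (h0 : q < 2 * j + 3) (hq : 4 ≤ q)
    (hq2 : q < 2 * j + 2) :
    Bmat j ⟨v, hv⟩ ⟨q, h0⟩ =
      if v = q then -2 else if v + 1 = q then 1 else if v = q + 1 then 1 else 0 := by
  simp only [Bmat, Matrix.of_apply]
  grind

/-- A negative elementary move, stated pointwise. -/
theorem move_of {j : ℕ} {k k' : Fin (2 * j + 3) → ℤ} (i : ℕ) (hi : i < 2 * j + 3)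
    (h1 : k ⟨i, hi⟩ = Bmat j ⟨i, hi⟩ ⟨i, hi⟩)
    (h2 : ∀ v : ℕ, ∀ hv : v < 2 * j + 3,
      k' ⟨v, hv⟩ = k ⟨v, hv⟩ - 2 * Bmat j ⟨v, hv⟩ ⟨i, hi⟩) :
    MoveEquiv (Bmat j) k k' :=
  Relation.ReflTransGen.single ⟨⟨i, hi⟩, Or.inr ⟨h1, funext fun v => h2 v.1 v.2⟩⟩

/-- Vector with prescribed first four entries and `-2` at (0-indexed) position `r`. -/
def hvec (j : ℕ) (a b c d : ℤ) (r : ℕ) : Fin (2 * j + 3) → ℤ := fun v =>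
  if (v : ℕ) = 0 then a
  else if (v : ℕ) = 1 then b
  else if (v : ℕ) = 2 then c
  else if (v : ℕ) = 3 then d
  else (if (v : ℕ) = 2 * j + 2 then 3 else 0) - (if (v : ℕ) = r then 2 else 0)

/-- Sweep state: about to move at (0-indexed) position `q`. -/
def wvec (j : ℕ) (c : ℤ) (r q : ℕ) : Fin (2 * j + 3) → ℤ := fun v =>
  (if (v : ℕ) = 0 then 1
  else if (v : ℕ) = 1 then 0
  else if (v : ℕ) = 2 then c
  else if (v : ℕ) = 3 then -1
  else (if (v : ℕ) = 2 * j + 2 then 3 else 0))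
  - (if (v : ℕ) = q then 2 else 0) + (if (v : ℕ) = q + 1 then 2 else 0)
  - (if (v : ℕ) = r then 2 else 0)

theorem head_moves (j : ℕ) (c : ℤ) (r : ℕ) (hr : 4 ≤ r) (hr2 : r < 2 * j + 2) :
    MoveEquiv (Bmat j) (hvec j (-1) 0 c 3 r) (wvec j (c - 4) (r + 1) r) := by
  have s1 : MoveEquiv (Bmat j) (hvec j (-1) 0 c 3 r) (hvec j 1 (-2) (c - 2) 1 r) := by
    refine move_of 0 (by omega) ?_ ?_
    · simp [hvec, Bmat]
    · intro v hv
      simp only [hvec, col0, col1, col3]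
      grind
  have s2 : MoveEquiv (Bmat j) (hvec j 1 (-2) (c - 2) 1 r) (hvec j (-1) 2 (c - 2) 1 r) := by
    refine move_of 1 (by omega) ?_ ?_
    · simp [hvec, Bmat]
    · intro v hv
      simp only [hvec, col0, col1, col3]
      grind
  have s3 : MoveEquiv (Bmat j) (hvec j (-1) 2 (c - 2) 1 r) (wvec j (c - 4) (r + 1) r) := by
    refine move_of 0 (by omega) ?_ ?_
    · simp [hvec, Bmat]
    · intro v hv
      simp only [hvec, wvec, col0, col1, col3]
      grind
  exact (s1.trans s2).trans s3

theorem sweep_step (j : ℕ) (c : ℤ) (r q : ℕ) (hq : 4 ≤ q) (hr : q < r) (hr2 : r < 2 * j + 3) :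
    MoveEquiv (Bmat j) (wvec j c r q) (wvec j c r (q - 1)) := by
  refine move_of q (by omega) ?_ ?_
  · simp only [wvec, colq j _ q _ _ hq (by omega)]
    grind
  · intro v hv
    simp only [wvec, colq j _ q _ _ hq (by omega)]
    grind

theorem sweep (j : ℕ) (c : ℤ) (r : ℕ) (hr2 : r < 2 * j + 3) (n : ℕ) (hr : n + 3 < r) :
    MoveEquiv (Bmat j) (wvec j c r (n + 3)) (wvec j c r 3) := by
  induction n with
  | zero => exact Relation.ReflTransGen.refl
  | succ n ih =>
    have h := sweep_step j c r (n + 1 + 3) (by omega) hr hr2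
    exact h.trans (ih (by omega))

theorem sweep_last (j : ℕ) (c : ℤ) (r : ℕ) (hr : 5 ≤ r) (hr2 : r < 2 * j + 3) :
    MoveEquiv (Bmat j) (wvec j c r 3) (hvec j (-1) 0 c 3 r) := by
  refine move_of 3 (by omega) ?_ ?_
  · simp only [wvec, col0, col1, col3]
    grind
  · intro v hv
    simp only [hvec, wvec, col0, col1, col3]
    grind

theorem rounds (j : ℕ) (c : ℤ) (m : ℕ) (hm : m + 4 < 2 * j + 3) :
    MoveEquiv (Bmat j) (hvec j (-1) 0 c 3 4) (hvec j (-1) 0 (c - 4 * m) 3 (m + 4)) := by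
  induction m with
  | zero =>
    simp only [Nat.cast_zero, mul_zero, sub_zero, Nat.zero_add]
    exact Relation.ReflTransGen.refl
  | succ m ih =>
    have a := ih (by omega)
    have b := head_moves j (c - 4 * m) (m + 4) (by omega) (by omega)
    have d := sweep j (c - 4 * m - 4) (m + 4 + 1) (by omega) (m + 1) (by omega)
    have e := sweep_last j (c - 4 * m - 4) (m + 4 + 1) (by omega) (by omega)
    have f := ((a.trans b).trans d).trans e
    have g1 : c - 4 * ((m + 1 : ℕ) : ℤ) = c - 4 * m - 4 := by push_cast; ring
    have g2 : m + 1 + 4 = m + 4 + 1 := by omega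
    rw [g1, g2]
    exact f

/-- for `j ≥ 1`, the vector `−k₁` is equivalent to `k₂` by a finite sequence
of elementary moves for `B_j`; this identifies the involution on the graded root of
`(−N_j, 𝔰₀)`, which swaps the two leaves represented by `k₁` and `k₂`. -/
theorem neg_k1_equiv_k2 (j : ℕ) (hj : 1 ≤ j) :
    MoveEquiv (Bmat j) (fun i => -(k1vec j i)) (k2vec j) := by
  have a : MoveEquiv (Bmat j) (fun i => -(k1vec j i)) (hvec j (-1) 0 (4 * j - 5) 3 4) := by
    refine move_of 3 (by omega) ?_ ?_
    · simp [k1vec, col3]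
    · intro v hv
      simp only [hvec, k1vec, col0, col1, col3]
      grind
  have b := rounds j (4 * j - 5) (2 * j - 2) (by omega)
  have e : hvec j (-1) 0 ((4 * j - 5 : ℤ) - 4 * ((2 * j - 2 : ℕ) : ℤ)) 3 (2 * j - 2 + 4)
      = k2vec j := by
    funext v
    simp only [hvec, k2vec]
    grind
  rw [e] at b
  exact a.trans b
end

section
/- Let j ≥ 1 be an integer and let B_j be as specified. Let k₁ = (−1, 0, 5−4j, 3, 0, …, 0, −3) ∈ ℤ^{2j+3} and k₂ = (−1, 0, 3−4j, 3, 0, …, 0, 1) ∈ ℤ^{2j+3} (entries in positions 5 through 2j+2 equal to zero). Then there exist vectors α₁, α₂ ∈ ℤ^{2j+3} such that B_j α₁ = k₁, B_j α₂ = k₂, and k₁ · α₁ = k₂ · α₂ = −2j − 2. -/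
/-- A sum over `Fin n` supported on at most four positions. -/
theorem sum_four (n : ℕ) (f : Fin n → ℤ) (a b c d : Fin n) (x y z t : ℤ)
    (h : ∀ i, f i = (if i = a then x else 0) + (if i = b then y else 0)
      + (if i = c then z else 0) + (if i = d then t else 0)) :
    ∑ i, f i = x + y + z + t := by
  rw [Finset.sum_congr rfl (fun i _ => h i)]
  simp [Finset.sum_add_distrib]

/-- The common shape of the two solutions. -/
def alphaVec (j : ℕ) (s : ℤ) : Fin (2 * j + 3) → ℤ := fun a =>
  if (a : ℕ) = 0 then 4 * (j : ℤ) + 4 - 2 * s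
  else if (a : ℕ) = 1 then 2 * (j : ℤ) + 2 - s
  else if (a : ℕ) = 2 then 1
  else 2 * (j : ℤ) + 3 - s - ((a : ℕ) : ℤ)

/-- The image vector. -/
def kVec (j : ℕ) (s : ℤ) : Fin (2 * j + 3) → ℤ := fun a =>
  if (a : ℕ) = 0 then -1
  else if (a : ℕ) = 1 then 0
  else if (a : ℕ) = 2 then 5 - 4 * (j : ℤ) - 2 * s
  else if (a : ℕ) = 3 then 3
  else if (a : ℕ) = 2 * j + 2 then -3 + 4 * s
  else 0

theorem mulVec_alpha (j : ℕ) (hj : 1 ≤ j) (s : ℤ) :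
    (Bmat j).mulVec (alphaVec j s) = kVec j s := by
  funext ⟨a, ha⟩
  simp only [Matrix.mulVec, dotProduct]
  by_cases h0 : a = 0
  · subst h0
    rw [sum_four _ _ ⟨0, by omega⟩ ⟨1, by omega⟩ ⟨2, by omega⟩ ⟨3, by omega⟩
      (-(4 * (j : ℤ) + 4 - 2 * s)) (2 * (j : ℤ) + 2 - s) 1 (2 * (j : ℤ) - s)]
    · simp [kVec]; ring
    · rintro ⟨i, hi⟩
      simp only [Bmat, alphaVec, Matrix.of_apply, Fin.mk.injEq]
      grind
  by_cases h1 : a = 1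
  · subst h1
    rw [sum_four _ _ ⟨0, by omega⟩ ⟨1, by omega⟩ ⟨2, by omega⟩ ⟨3, by omega⟩
      (4 * (j : ℤ) + 4 - 2 * s) (-2 * (2 * (j : ℤ) + 2 - s)) 0 0]
    · simp [kVec]; ring
    · rintro ⟨i, hi⟩
      simp only [Bmat, alphaVec, Matrix.of_apply, Fin.mk.injEq]
      grind
  by_cases h2 : a = 2
  · subst h2
    rw [sum_four _ _ ⟨0, by omega⟩ ⟨1, by omega⟩ ⟨2, by omega⟩ ⟨3, by omega⟩
      (4 * (j : ℤ) + 4 - 2 * s) 0 (1 - 8 * (j : ℤ)) 0]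
    · simp [kVec]; ring
    · rintro ⟨i, hi⟩
      simp only [Bmat, alphaVec, Matrix.of_apply, Fin.mk.injEq]
      grind
  by_cases h3 : a = 3
  · subst h3
    rw [sum_four _ _ ⟨0, by omega⟩ ⟨1, by omega⟩ ⟨3, by omega⟩ ⟨4, by omega⟩
      (4 * (j : ℤ) + 4 - 2 * s) 0 (-3 * (2 * (j : ℤ) - s)) (2 * (j : ℤ) - 1 - s)]
    · simp [kVec]; ring
    · rintro ⟨i, hi⟩
      simp only [Bmat, alphaVec, Matrix.of_apply, Fin.mk.injEq]
      grind
  by_cases hl : a = 2 * j + 2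
  · subst hl
    rw [sum_four _ _ ⟨0, by omega⟩ ⟨1, by omega⟩ ⟨2 * j + 1, by omega⟩ ⟨2 * j + 2, by omega⟩
      0 0 (2 - s) (-5 * (1 - s))]
    · simp only [kVec]; grind
    · rintro ⟨i, hi⟩
      simp only [Bmat, alphaVec, Matrix.of_apply, Fin.mk.injEq]
      grind
  · rw [sum_four _ _ ⟨0, by omega⟩ ⟨a - 1, by omega⟩ ⟨a, by omega⟩ ⟨a + 1, by omega⟩
      0 (2 * (j : ℤ) + 4 - s - a) (-2 * (2 * (j : ℤ) + 3 - s - a)) (2 * (j : ℤ) + 2 - s - a)]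
    · simp only [kVec]; grind
    · rintro ⟨i, hi⟩
      simp only [Bmat, alphaVec, Matrix.of_apply, Fin.mk.injEq]
      grind

theorem k_dot_alpha (j : ℕ) (hj : 1 ≤ j) (s : ℤ) :
    ∑ i, kVec j s i * alphaVec j s i
      = -(4 * (j : ℤ) + 4 - 2 * s) + (5 - 4 * (j : ℤ) - 2 * s)
        + 3 * (2 * (j : ℤ) - s) + (-3 + 4 * s) * (1 - s) := by
  refine sum_four _ _ ⟨0, by omega⟩ ⟨2, by omega⟩ ⟨3, by omega⟩ ⟨2 * j + 2, by omega⟩ _ _ _ _ ?_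
  rintro ⟨i, hi⟩
  by_cases hl : i = 2 * j + 2
  · subst hl
    have e0 : ¬ (2 * j + 2 = 0) := by omega
    have e1 : ¬ (2 * j + 2 = 1) := by omega
    have e2 : ¬ (2 * j + 2 = 2) := by omega
    have e3 : ¬ (2 * j + 2 = 3) := by omega
    simp only [kVec, alphaVec, Fin.mk.injEq, e0, e1, e2, e3, if_true, if_false]
    push_cast
    ring
  · simp only [kVec, alphaVec, Fin.mk.injEq]
    grind

theorem k1vec_eq (j : ℕ) : k1vec j = kVec j 0 := by
  funext ⟨a, ha⟩
  simp only [k1vec, kVec]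
  grind

theorem k2vec_eq (j : ℕ) : k2vec j = kVec j 1 := by
  funext ⟨a, ha⟩
  simp only [k2vec, kVec]
  grind

/-- for `j ≥ 1` there are vectors `α₁, α₂ ∈ ℤ^{2j+3}` with `B_j α₁ = k₁`,
`B_j α₂ = k₂`, and `k₁ · α₁ = k₂ · α₂ = −2j − 2`; i.e. the self-intersections of the
characteristic vectors `k₁` and `k₂` equal `−2j − 2`. -/
theorem k1_k2_square (j : ℕ) (hj : 1 ≤ j) :
    ∃ α₁ α₂ : Fin (2 * j + 3) → ℤ,
      (Bmat j).mulVec α₁ = k1vec j ∧ (Bmat j).mulVec α₂ = k2vec j ∧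
      (∑ i, k1vec j i * α₁ i) = -2 * (j : ℤ) - 2 ∧
      (∑ i, k2vec j i * α₂ i) = -2 * (j : ℤ) - 2 := by
  refine ⟨alphaVec j 0, alphaVec j 1, ?_, ?_, ?_, ?_⟩
  · rw [k1vec_eq, mulVec_alpha j hj]
  · rw [k2vec_eq, mulVec_alpha j hj]
  · rw [k1vec_eq, k_dot_alpha j hj]; ring
  · rw [k2vec_eq, k_dot_alpha j hj]; ring
end
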